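/- arXiv:1704.04975 — 4 statements merged into one kernel-verified Lean document; each statement's English description precedes it below -/
import Mathlib

section
/- Let d ∈ k be such that the triple (a', b', c') := (a+αd, b+βd, c+γd) satisfies: no two of a', b', c' are simultaneously zero, and it is not the case that a'³ = b'³ = c'³. Then the element ħ − d is a regular element of the extended formal Sklyanin algebra S_ħ, i.e., (ħ−d)·s = 0 implies s = 0 and s·(ħ−d) = 0 implies s = 0 for s ∈ S_ħ. -/
noncomputable section

/-- The defining relations of the 3-dimensional Sklyanin algebra `S(a,b,c)`:
`a·yz + b·zy + c·x²`, `a·zx + b·xz + c·y²`, `a·xy + b·yx + c·z²` are set to zero.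
The generators `x, y, z` are the images of `FreeAlgebra.ι k 0, 1, 2`. -/
inductive SklyaninRel (k : Type*) [CommRing k] (a b c : k) :
    FreeAlgebra k (Fin 3) → FreeAlgebra k (Fin 3) → Prop
  | r1 : SklyaninRel k a b c
      (a • (FreeAlgebra.ι k 1 * FreeAlgebra.ι k 2) + b • (FreeAlgebra.ι k 2 * FreeAlgebra.ι k 1)
        + c • (FreeAlgebra.ι k 0 * FreeAlgebra.ι k 0)) 0
  | r2 : SklyaninRel k a b c
      (a • (FreeAlgebra.ι k 2 * FreeAlgebra.ι k 0) + b • (FreeAlgebra.ι k 0 * FreeAlgebra.ι k 2)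
        + c • (FreeAlgebra.ι k 1 * FreeAlgebra.ι k 1)) 0
  | r3 : SklyaninRel k a b c
      (a • (FreeAlgebra.ι k 0 * FreeAlgebra.ι k 1) + b • (FreeAlgebra.ι k 1 * FreeAlgebra.ι k 0)
        + c • (FreeAlgebra.ι k 2 * FreeAlgebra.ι k 2)) 0

/-- The 3-dimensional Sklyanin algebra `S(a,b,c)`: the quotient of the free algebra
`k⟨x,y,z⟩` by the two-sided ideal generated by the three Sklyanin relations. -/
def Sklyanin (k : Type*) [CommRing k] (a b c : k) : Type _ := RingQuot (SklyaninRel k a b c)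

instance (k : Type*) [CommRing k] (a b c : k) : Ring (Sklyanin k a b c) := by
  unfold Sklyanin; infer_instance

instance (k : Type*) [CommRing k] (a b c : k) : Algebra k (Sklyanin k a b c) := by
  unfold Sklyanin; infer_instance

namespace Sklyanin

variable (k : Type*) [CommRing k] (a b c : k)

/-- The generator `x` of `S(a,b,c)`. -/
def X : Sklyanin k a b c := RingQuot.mkAlgHom k (SklyaninRel k a b c) (FreeAlgebra.ι k 0)
/-- The generator `y` of `S(a,b,c)`. -/
def Y : Sklyanin k a b c := RingQuot.mkAlgHom k (SklyaninRel k a b c) (FreeAlgebra.ι k 1)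
/-- The generator `z` of `S(a,b,c)`. -/
def Z : Sklyanin k a b c := RingQuot.mkAlgHom k (SklyaninRel k a b c) (FreeAlgebra.ι k 2)

/-- The canonical central element
`g = c(c³−b³)y³ + b(c³−a³)yxz + a(b³−c³)xyz + c(a³−c³)x³` of `S(a,b,c)`. -/
def g : Sklyanin k a b c :=
  (c * (c ^ 3 - b ^ 3)) • (Y k a b c * Y k a b c * Y k a b c)
    + (b * (c ^ 3 - a ^ 3)) • (Y k a b c * X k a b c * Z k a b c)
    + (a * (b ^ 3 - c ^ 3)) • (X k a b c * Y k a b c * Z k a b c)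
    + (c * (a ^ 3 - c ^ 3)) • (X k a b c * X k a b c * X k a b c)

end Sklyanin

namespace Sklyanin

section General

variable {k : Type*} [CommRing k] {a b c : k}

variable (k a b c) in
/-- The quotient map from the free algebra. -/
def mk : FreeAlgebra k (Fin 3) →ₐ[k] Sklyanin k a b c :=
  RingQuot.mkAlgHom k (SklyaninRel k a b c)

variable (k a b c) in
/-- The three generators as a family. -/
def gen (i : Fin 3) : Sklyanin k a b c := mk k a b c (FreeAlgebra.ι k i)

theorem mk_surjective : Function.Surjective (mk k a b c) :=
  RingQuot.mkAlgHom_surjective k (SklyaninRel k a b c)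

theorem gen_rel (i : Fin 3) :
    a • (gen k a b c (i + 1) * gen k a b c (i + 2))
      + b • (gen k a b c (i + 2) * gen k a b c (i + 1))
      + c • (gen k a b c i * gen k a b c i) = 0 := by
  have h1 := RingQuot.mkAlgHom_rel k (SklyaninRel.r1 (k := k) (a := a) (b := b) (c := c))
  have h2 := RingQuot.mkAlgHom_rel k (SklyaninRel.r2 (k := k) (a := a) (b := b) (c := c))
  have h3 := RingQuot.mkAlgHom_rel k (SklyaninRel.r3 (k := k) (a := a) (b := b) (c := c))
  change mk k a b c _ = mk k a b c _ at h1 h2 h3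
  simp only [map_add, map_smul, map_mul, map_zero] at h1 h2 h3
  fin_cases i
  exacts [h1, h2, h3]

section Lift

variable {B : Type*} [Ring B] [Algebra k B] (f : Fin 3 → B)
  (hf : ∀ i, a • (f (i + 1) * f (i + 2)) + b • (f (i + 2) * f (i + 1)) + c • (f i * f i) = 0)

/-- The universal property of the Sklyanin algebra. -/
def lift : Sklyanin k a b c →ₐ[k] B :=
  RingQuot.liftAlgHom k ⟨FreeAlgebra.lift k f, by
    rintro _ _ (_ | _ | _)
    · simpa using hf 0
    · simpa using hf 1
    · simpa using hf 2⟩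

@[simp]
theorem lift_gen (i : Fin 3) : lift f hf (gen k a b c i) = f i := by
  have h := RingQuot.liftAlgHom_mkAlgHom_apply k (FreeAlgebra.lift k f)
    (s := SklyaninRel k a b c) (by
    rintro _ _ (_ | _ | _)
    · simpa using hf 0
    · simpa using hf 1
    · simpa using hf 2) (FreeAlgebra.ι k i)
  exact h.trans (FreeAlgebra.lift_ι_apply f i)

end Lift

attribute [local irreducible] instRingSklyanin

theorem adjoin_range_gen : Algebra.adjoin k (Set.range (gen k a b c)) = ⊤ := by
  have h : Set.range (gen k a b c) = mk k a b c '' Set.range (FreeAlgebra.ι k) := by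
    rw [← Set.range_comp]; rfl
  rw [h, ← AlgHom.map_adjoin, FreeAlgebra.adjoin_range_ι, Algebra.map_top,
    AlgHom.range_eq_top]
  exact mk_surjective

/-- A submodule containing `1` and stable under left multiplication by the generators is
everything. -/
theorem mem_of_gen_mul_mem (M : Submodule k (Sklyanin k a b c)) (h1 : (1 : Sklyanin k a b c) ∈ M)
    (hM : ∀ i, ∀ s ∈ M, gen k a b c i * s ∈ M) (s : Sklyanin k a b c) : s ∈ M := by
  have key : ∀ u ∈ Algebra.adjoin k (Set.range (gen k a b c)), ∀ m ∈ M, u * m ∈ M := by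
    intro u hu
    induction hu using Algebra.adjoin_induction with
    | mem x hx => obtain ⟨i, rfl⟩ := hx; exact hM i
    | algebraMap r => intro m hm; rw [← Algebra.smul_def]; exact M.smul_mem _ hm
    | add x y _ _ hx hy => intro m hm; rw [add_mul]; exact M.add_mem (hx m hm) (hy m hm)
    | mul x y _ _ hx hy => intro m hm; rw [mul_assoc]; exact hx _ (hy m hm)
  simpa using key s (adjoin_range_gen (a := a) (b := b) (c := c) ▸ Algebra.mem_top) 1 h1

variable (k a b c) in
/-- The augmentation sending the generators to zero. -/
def aug : Sklyanin k a b c →ₐ[k] k := lift (fun _ => 0) (by simp)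

/-! ### The Koszul complex -/

variable (k a b c) in
/-- `σ ↦ x σ₀ + y σ₁ + z σ₂`. -/
def D1 : (Fin 3 → Sklyanin k a b c) →ₗ[k] Sklyanin k a b c where
  toFun σ := ∑ i, gen k a b c i * σ i
  map_add' σ τ := by simp [mul_add, Finset.sum_add_distrib]
  map_smul' r σ := by simp [Finset.smul_sum]

variable (k a b c) in
/-- The map whose matrix entries come from writing the relations as `∑ xⱼ Nᵢⱼ`. -/
def D2 : (Fin 3 → Sklyanin k a b c) →ₗ[k] (Fin 3 → Sklyanin k a b c) where
  toFun ρ j := a • (gen k a b c (j + 1) * ρ (j + 2)) + b • (gen k a b c (j + 2) * ρ (j + 1))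
    + c • (gen k a b c j * ρ j)
  map_add' σ τ := by ext j; simp only [Pi.add_apply, mul_add, smul_add]; abel
  map_smul' r σ := by
    ext j
    simp only [Pi.smul_apply, mul_smul_comm, smul_add, RingHom.id_apply]
    simp only [smul_comm r]

variable (k a b c) in
/-- `τ ↦ (x τ, y τ, z τ)`. -/
def D3 : Sklyanin k a b c →ₗ[k] (Fin 3 → Sklyanin k a b c) where
  toFun τ i := gen k a b c i * τ
  map_add' σ τ := by ext j; simp [mul_add]
  map_smul' r σ := by ext j; simp

theorem D1_apply (σ : Fin 3 → Sklyanin k a b c) : D1 k a b c σ = ∑ i, gen k a b c i * σ i := rfl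

theorem D2_apply (ρ : Fin 3 → Sklyanin k a b c) (j : Fin 3) : D2 k a b c ρ j =
    a • (gen k a b c (j + 1) * ρ (j + 2)) + b • (gen k a b c (j + 2) * ρ (j + 1))
    + c • (gen k a b c j * ρ j) := rfl

theorem D3_apply (τ : Sklyanin k a b c) (i : Fin 3) : D3 k a b c τ i = gen k a b c i * τ := rfl

theorem D1_single (i : Fin 3) (s : Sklyanin k a b c) :
    D1 k a b c (Pi.single i s) = gen k a b c i * s := by
  rw [D1_apply, Finset.sum_eq_single i]
  · simp
  · intro j _ hj; simp [hj]
  · simp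

theorem D2_D3 (τ : Sklyanin k a b c) : D2 k a b c (D3 k a b c τ) = 0 := by
  ext j
  have h := congrArg (· * τ) (gen_rel (a := a) (b := b) (c := c) j)
  simpa only [D2_apply, D3_apply, add_mul, smul_mul_assoc, mul_assoc, zero_mul, Pi.zero_apply]
    using h

theorem D1_D2 (ρ : Fin 3 → Sklyanin k a b c) : D1 k a b c (D2 k a b c ρ) = 0 := by
  have h : ∀ i : Fin 3, (a • (gen k a b c (i + 1) * gen k a b c (i + 2))
      + b • (gen k a b c (i + 2) * gen k a b c (i + 1))
      + c • (gen k a b c i * gen k a b c i)) * ρ i = 0 := fun i => by rw [gen_rel, zero_mul]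
  have h0 := h 0
  have h1 := h 1
  have h2 := h 2
  simp only [Fin.isValue, zero_add, show (1 : Fin 3) + 1 = 2 from rfl,
    show (1 : Fin 3) + 2 = 0 from rfl,
    show (2 : Fin 3) + 1 = 0 from rfl, show (2 : Fin 3) + 2 = 1 from rfl, add_mul,
    smul_mul_assoc, mul_assoc] at h0 h1 h2
  simp only [D1_apply, D2_apply, Fin.sum_univ_three, Fin.isValue, zero_add,
    show (1 : Fin 3) + 1 = 2 from rfl, show (1 : Fin 3) + 2 = 0 from rfl,
    show (2 : Fin 3) + 1 = 0 from rfl, show (2 : Fin 3) + 2 = 1 from rfl, mul_add,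
    mul_smul_comm]
  rw [← add_zero (0 : Sklyanin k a b c), ← add_zero (0 + 0 : Sklyanin k a b c)]
  nth_rewrite 1 [← h0]
  nth_rewrite 1 [← h1]
  nth_rewrite 1 [← h2]
  abel

theorem exists_eq_add_D1 (s : Sklyanin k a b c) :
    ∃ (r : k) (σ : Fin 3 → Sklyanin k a b c), s = algebraMap k _ r + D1 k a b c σ := by
  have h : s ∈ LinearMap.range (Algebra.linearMap k (Sklyanin k a b c)) ⊔
      LinearMap.range (D1 k a b c) := by
    refine mem_of_gen_mul_mem _ ?_ ?_ s
    · exact Submodule.mem_sup_left ⟨1, by simp⟩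
    · exact fun i s _ => Submodule.mem_sup_right ⟨Pi.single i s, D1_single i s⟩
  obtain ⟨_, ⟨r, rfl⟩, _, ⟨σ, rfl⟩, h⟩ := Submodule.mem_sup.1 h
  exact ⟨r, σ, h.symm⟩

theorem aug_D1 (σ : Fin 3 → Sklyanin k a b c) : aug k a b c (D1 k a b c σ) = 0 := by
  simp [D1_apply, aug]

variable (k a b c) in
/-- The realization of the algebra generated by `1` and the cokernel of `D2`. -/
def presentationMap :
    (k × ((Fin 3 → Sklyanin k a b c) ⧸ LinearMap.range (D2 k a b c))) →ₗ[k] Sklyanin k a b c :=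
  LinearMap.coprod (Algebra.linearMap k _)
    ((LinearMap.range (D2 k a b c)).liftQ (D1 k a b c) (by
      rintro _ ⟨ρ, rfl⟩; exact D1_D2 ρ))

variable (k a b c) in
/-- Left multiplication by a generator on `k × coker D2`. -/
def presentationGen (i : Fin 3) :
    Module.End k (k × ((Fin 3 → Sklyanin k a b c) ⧸ LinearMap.range (D2 k a b c))) :=
  LinearMap.inr k _ _ ∘ₗ (LinearMap.range (D2 k a b c)).mkQ ∘ₗ
    LinearMap.single k (fun _ => Sklyanin k a b c) i ∘ₗ presentationMap k a b c

theorem presentationMap_gen (i : Fin 3)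
    (q : k × ((Fin 3 → Sklyanin k a b c) ⧸ LinearMap.range (D2 k a b c))) :
    presentationMap k a b c (presentationGen k a b c i q) =
      gen k a b c i * presentationMap k a b c q := by
  conv_lhs => rw [presentationMap]
  simp [presentationGen, D1_single]

theorem D2_single (i : Fin 3) (s : Sklyanin k a b c) : D2 k a b c (Pi.single i s) =
    Pi.single (i + 1) (a • (gen k a b c (i + 2) * s))
      + Pi.single (i + 2) (b • (gen k a b c (i + 1) * s))
      + Pi.single i (c • (gen k a b c i * s)) := by
  ext j
  fin_cases i <;> fin_cases j <;> simp [D2_apply]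

theorem presentationGen_apply (i : Fin 3)
    (q : k × ((Fin 3 → Sklyanin k a b c) ⧸ LinearMap.range (D2 k a b c))) :
    presentationGen k a b c i q = (0, (LinearMap.range (D2 k a b c)).mkQ
      (Pi.single i (presentationMap k a b c q))) := rfl

variable (k a b c) in
/-- The action of the algebra on `k × coker D2`. -/
def presentationAct : Sklyanin k a b c →ₐ[k]
    Module.End k (k × ((Fin 3 → Sklyanin k a b c) ⧸ LinearMap.range (D2 k a b c))) :=
  lift (presentationGen k a b c) (by
    intro i
    refine LinearMap.ext fun q => ?_
    have h : (LinearMap.range (D2 k a b c)).mkQ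
        (D2 k a b c (Pi.single i (presentationMap k a b c q))) = 0 := by
      rw [Submodule.mkQ_apply, Submodule.Quotient.mk_eq_zero]
      exact ⟨_, rfl⟩
    rw [D2_single] at h
    simp only [LinearMap.add_apply, LinearMap.smul_apply, Module.End.mul_apply,
      LinearMap.zero_apply, presentationGen_apply i, presentationGen_apply (i + 1),
      presentationGen_apply (i + 2)]
    simp only [← presentationGen_apply, presentationMap_gen]
    simpa only [Prod.smul_mk, Prod.mk_add_mk, ← map_smul, ← map_add, smul_zero, add_zero,
      Pi.single_smul, Prod.mk_eq_zero, true_and] using h)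

theorem presentationMap_act (s : Sklyanin k a b c)
    (q : k × ((Fin 3 → Sklyanin k a b c) ⧸ LinearMap.range (D2 k a b c))) :
    presentationMap k a b c (presentationAct k a b c s q) = s * presentationMap k a b c q := by
  have h : s ∈ LinearMap.ker ((LinearMap.mulRight k (presentationMap k a b c q)) -
      presentationMap k a b c ∘ₗ LinearMap.applyₗ q ∘ₗ (presentationAct k a b c).toLinearMap) := by
    refine mem_of_gen_mul_mem _ ?_ ?_ s
    · simp
    · intro i s hs
      simp only [LinearMap.mem_ker, LinearMap.sub_apply, LinearMap.mulRight_apply,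
        LinearMap.comp_apply, AlgHom.toLinearMap_apply, LinearMap.applyₗ_apply_apply,
        sub_eq_zero] at hs ⊢
      rw [map_mul, Module.End.mul_apply, mul_assoc, hs]
      simp [presentationAct, presentationMap_gen]
  simp only [LinearMap.mem_ker, LinearMap.sub_apply, LinearMap.mulRight_apply,
        LinearMap.comp_apply, AlgHom.toLinearMap_apply, LinearMap.applyₗ_apply_apply,
        sub_eq_zero] at h
  exact h.symm

/-- The Koszul complex is exact at the term of the generators. -/
theorem exists_D2_eq {σ : Fin 3 → Sklyanin k a b c} (h : D1 k a b c σ = 0) :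
    ∃ ρ, D2 k a b c ρ = σ := by
  have key : presentationAct k a b c (D1 k a b c σ) (1, 0) =
      (0, (LinearMap.range (D2 k a b c)).mkQ σ) := by
    have h1 : presentationMap k a b c (1, 0) = 1 := by simp [presentationMap]
    have h2 : ∀ i, presentationAct k a b c (gen k a b c i * σ i) (1, 0) =
        LinearMap.inr k k _ ((LinearMap.range (D2 k a b c)).mkQ (Pi.single i (σ i))) := by
      intro i
      rw [map_mul, Module.End.mul_apply]
      conv_lhs => rw [presentationAct, lift_gen, ← presentationAct, presentationGen]
      simp only [LinearMap.comp_apply, presentationMap_act, h1, mul_one]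
      rfl
    rw [D1_apply, map_sum, LinearMap.sum_apply, Finset.sum_congr rfl fun i _ => h2 i, ← map_sum,
      ← map_sum, Finset.univ_sum_single]
    rfl
  rw [h, map_zero, LinearMap.zero_apply] at key
  have h3 := (Prod.ext_iff.1 key).2
  simpa using h3.symm

/-! ### The grading -/

variable (k a b c) in
/-- The homogenization map `x ↦ x T`, recording the degree in an auxiliary variable. -/
def homog : Sklyanin k a b c →ₐ[k] Polynomial (Sklyanin k a b c) :=
  lift (fun i => Polynomial.C (gen k a b c i) * Polynomial.X) (by
    intro i
    have key : ∀ u v : Sklyanin k a b c, Polynomial.C u * Polynomial.X *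
        (Polynomial.C v * Polynomial.X) = Polynomial.C (u * v) * Polynomial.X ^ 2 := by
      intro u v
      rw [mul_assoc, ← mul_assoc Polynomial.X, Polynomial.X_mul_C, map_mul, pow_two]
      simp only [mul_assoc]
    rw [key, key, key]
    rw [← smul_mul_assoc, ← smul_mul_assoc, ← smul_mul_assoc, Polynomial.smul_C, Polynomial.smul_C,
      Polynomial.smul_C, ← add_mul, ← add_mul, ← map_add, ← map_add, gen_rel, map_zero, zero_mul])

variable (k a b c) in
/-- The homogeneous component of degree `n`. -/
def comp (n : ℕ) : Sklyanin k a b c →ₗ[k] Sklyanin k a b c where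
  toFun s := (homog k a b c s).coeff n
  map_add' s t := by simp
  map_smul' r s := by simp

theorem comp_apply (n : ℕ) (s : Sklyanin k a b c) :
    comp k a b c n s = (homog k a b c s).coeff n := rfl

theorem homog_gen_mul (i : Fin 3) (s : Sklyanin k a b c) : homog k a b c (gen k a b c i * s) =
    Polynomial.C (gen k a b c i) * (homog k a b c s * Polynomial.X) := by
  rw [map_mul, homog, lift_gen, mul_assoc, Polynomial.X_mul]

@[simp]
theorem comp_succ_gen_mul (n : ℕ) (i : Fin 3) (s : Sklyanin k a b c) :
    comp k a b c (n + 1) (gen k a b c i * s) = gen k a b c i * comp k a b c n s := by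
  rw [comp_apply, homog_gen_mul, Polynomial.coeff_C_mul, Polynomial.coeff_mul_X, comp_apply]

@[simp]
theorem comp_zero_gen_mul (i : Fin 3) (s : Sklyanin k a b c) :
    comp k a b c 0 (gen k a b c i * s) = 0 := by
  rw [comp_apply, homog_gen_mul, Polynomial.coeff_C_mul, Polynomial.coeff_mul_X_zero, mul_zero]

theorem comp_one (n : ℕ) : comp k a b c n 1 = if n = 0 then 1 else 0 := by
  rw [comp_apply, map_one, Polynomial.coeff_one]

theorem eq_sum_comp (s : Sklyanin k a b c) :
    ∃ N, ∀ n, N ≤ n → s = ∑ i ∈ Finset.range n, comp k a b c i s := by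
  refine ⟨(homog k a b c s).natDegree + 1, fun n hn => ?_⟩
  have h1 : ∀ s, (homog k a b c s).eval 1 = s := by
    intro s
    have h : s ∈ LinearMap.ker ((Polynomial.leval (1 : Sklyanin k a b c)).restrictScalars k ∘ₗ
        (homog k a b c).toLinearMap - LinearMap.id) := by
      refine mem_of_gen_mul_mem _ ?_ ?_ s
      · simp
      · intro i s hs
        simp only [LinearMap.mem_ker, LinearMap.sub_apply, LinearMap.comp_apply,
          LinearMap.restrictScalars_apply, AlgHom.toLinearMap_apply, Polynomial.leval_apply,
          LinearMap.id_apply, sub_eq_zero] at hs ⊢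
        rw [homog_gen_mul, Polynomial.eval_C_mul, Polynomial.eval_mul_X, hs, mul_one]
    simpa [sub_eq_zero] using h
  conv_lhs => rw [← h1 s, Polynomial.eval_eq_sum_range' (Nat.lt_of_succ_le hn)]
  simp [comp_apply]

variable (k a b c) in
/-- The span of the generators. -/
def V : Submodule k (Sklyanin k a b c) := Submodule.span k (Set.range (gen k a b c))

theorem gen_mem_V (i : Fin 3) : gen k a b c i ∈ V k a b c := Submodule.subset_span ⟨i, rfl⟩

theorem V_mul_le {M N : Submodule k (Sklyanin k a b c)} :
    V k a b c * M ≤ N ↔ ∀ i, ∀ s ∈ M, gen k a b c i * s ∈ N := by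
  constructor
  · exact fun h i s hs => h (Submodule.mul_mem_mul (gen_mem_V i) hs)
  · intro h
    rw [Submodule.mul_le]
    intro v hv s hs
    induction hv using Submodule.span_induction with
    | mem x hx => obtain ⟨i, rfl⟩ := hx; exact h i s hs
    | zero => simp
    | add x y _ _ hx hy => rw [add_mul]; exact N.add_mem hx hy
    | smul r x _ hx => rw [smul_mul_assoc]; exact N.smul_mem r hx

theorem comp_mem (n : ℕ) (s : Sklyanin k a b c) : comp k a b c n s ∈ V k a b c ^ n := by
  have h : s ∈ ⨅ n, (V k a b c ^ n).comap (comp k a b c n) := by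
    refine mem_of_gen_mul_mem _ ?_ ?_ s
    · simp only [Submodule.mem_iInf, Submodule.mem_comap, comp_one]
      rintro (_ | n)
      · simp [Submodule.one_le.1 le_rfl]
      · simp
    · simp only [Submodule.mem_iInf, Submodule.mem_comap]
      rintro i s hs (_ | n)
      · simp
      · rw [comp_succ_gen_mul, pow_succ']
        exact Submodule.mul_mem_mul (gen_mem_V i) (hs n)
  simp only [Submodule.mem_iInf, Submodule.mem_comap] at h
  exact h n

theorem comp_of_mem {n : ℕ} {s : Sklyanin k a b c} (hs : s ∈ V k a b c ^ n) :
    comp k a b c n s = s := by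
  suffices h : V k a b c ^ n ≤ LinearMap.ker (comp k a b c n - LinearMap.id) by
    simpa [sub_eq_zero] using h hs
  clear hs
  induction n with
  | zero =>
    rw [pow_zero, Submodule.one_le]
    simp [comp_one]
  | succ n ih =>
    rw [pow_succ', V_mul_le]
    intro i s hs
    have := ih hs
    simp only [LinearMap.mem_ker, LinearMap.sub_apply, LinearMap.id_apply, sub_eq_zero] at this ⊢
    rw [comp_succ_gen_mul, this]

/-- The components vanish on a set contained in its own products with the generators. -/
theorem eq_zero_of_forall_exists_D1 (T : Set (Sklyanin k a b c))
    (hT : ∀ s ∈ T, ∃ σ : Fin 3 → Sklyanin k a b c, (∀ i, σ i ∈ T) ∧ s = D1 k a b c σ) :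
    ∀ s ∈ T, s = 0 := by
  have h : ∀ n, ∀ s ∈ T, comp k a b c n s = 0 := by
    intro n
    induction n with
    | zero =>
      intro s hs
      obtain ⟨σ, -, rfl⟩ := hT s hs
      simp [D1_apply]
    | succ n ih =>
      intro s hs
      obtain ⟨σ, hσ, rfl⟩ := hT s hs
      simp [D1_apply, ih _ (hσ _)]
  intro s hs
  obtain ⟨N, hN⟩ := eq_sum_comp s
  rw [hN N le_rfl, Finset.sum_eq_zero fun i _ => h i s hs]

/-- The graded pieces, with the degree shifted by two. -/
def G (k : Type*) [CommRing k] (a b c : k) : ℕ → Submodule k (Sklyanin k a b c)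
  | 0 => ⊥
  | 1 => ⊥
  | n + 2 => V k a b c ^ n

theorem gen_mul_mem_G {n : ℕ} (i : Fin 3) {s : Sklyanin k a b c} (hs : s ∈ G k a b c n) :
    gen k a b c i * s ∈ G k a b c (n + 1) := by
  match n with
  | 0 | 1 =>
    rw [show s = 0 by simpa [G] using hs, mul_zero]
    exact Submodule.zero_mem _
  | n + 2 =>
    change _ ∈ V k a b c ^ (n + 1)
    rw [pow_succ']
    exact Submodule.mul_mem_mul (gen_mem_V i) hs

variable (k a b c) in
/-- Triples of homogeneous elements of the same shifted degree. -/
def W (n : ℕ) : Submodule k (Fin 3 → Sklyanin k a b c) :=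
  Submodule.pi Set.univ (fun _ => G k a b c n)

theorem mem_W {n : ℕ} {σ : Fin 3 → Sklyanin k a b c} :
    σ ∈ W k a b c n ↔ ∀ i, σ i ∈ G k a b c n := by simp [W]

theorem D2_mem_W {n : ℕ} {ρ : Fin 3 → Sklyanin k a b c} (h : ρ ∈ W k a b c n) :
    D2 k a b c ρ ∈ W k a b c (n + 1) := by
  rw [mem_W] at h ⊢
  intro j
  rw [D2_apply]
  exact Submodule.add_mem _ (Submodule.add_mem _ (Submodule.smul_mem _ _ (gen_mul_mem_G _ (h _)))
    (Submodule.smul_mem _ _ (gen_mul_mem_G _ (h _))))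
    (Submodule.smul_mem _ _ (gen_mul_mem_G _ (h _)))

theorem map_D1_W (n : ℕ) : (W k a b c (n + 2)).map (D1 k a b c) = G k a b c (n + 3) := by
  apply le_antisymm
  · rintro _ ⟨σ, hσ, rfl⟩
    rw [D1_apply]
    exact Submodule.sum_mem _ fun i _ => gen_mul_mem_G i (mem_W.1 hσ i)
  · change V k a b c ^ (n + 1) ≤ _
    rw [pow_succ', V_mul_le]
    intro i s hs
    refine ⟨Pi.single i s, mem_W.2 fun j => ?_, D1_single i s⟩
    rcases eq_or_ne j i with rfl | h
    · rw [Pi.single_eq_same]; exact hs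
    · simp [h]

theorem map_D2_W (n : ℕ) :
    (W k a b c (n + 1)).map (D2 k a b c) = LinearMap.ker (D1 k a b c) ⊓ W k a b c (n + 2) := by
  apply le_antisymm
  · rintro _ ⟨ρ, hρ, rfl⟩
    exact ⟨D1_D2 ρ, D2_mem_W hρ⟩
  · rintro σ ⟨h1, h2⟩
    obtain ⟨ρ, rfl⟩ := exists_D2_eq h1
    have h3 : ∀ j, comp k a b c n (D2 k a b c ρ j) = D2 k a b c ρ j := fun j =>
      comp_of_mem (mem_W.1 h2 j)
    match n with
    | 0 =>
      refine ⟨0, Submodule.zero_mem _, ?_⟩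
      ext j
      rw [← h3]
      simp [D2_apply]
    | n + 1 =>
      refine ⟨fun i => comp k a b c n (ρ i), mem_W.2 fun i => comp_mem n _, ?_⟩
      ext j
      rw [← h3]
      simp [D2_apply]

theorem map_D3_G_le (n : ℕ) :
    (G k a b c n).map (D3 k a b c) ≤ LinearMap.ker (D2 k a b c) ⊓ W k a b c (n + 1) := by
  rintro _ ⟨τ, hτ, rfl⟩
  exact ⟨D2_D3 τ, mem_W.2 fun i => gen_mul_mem_G i hτ⟩

/-- Exactness at the relations may be checked on homogeneous elements. -/
theorem ker_D2_le_of_homogeneous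
    (h : ∀ n, LinearMap.ker (D2 k a b c) ⊓ W k a b c n ≤ LinearMap.range (D3 k a b c)) :
    LinearMap.ker (D2 k a b c) ≤ LinearMap.range (D3 k a b c) := by
  intro ρ hρ
  choose N hN using fun i => eq_sum_comp (ρ i)
  have h1 : ρ = ∑ n ∈ Finset.range (∑ i, N i), fun i => comp k a b c n (ρ i) := by
    ext i
    rw [Finset.sum_apply]
    exact hN i _ (Finset.single_le_sum (fun _ _ => Nat.zero_le _) (Finset.mem_univ i))
  rw [h1]
  refine Submodule.sum_mem _ fun n _ => h (n + 2) ⟨?_, mem_W.2 fun i => comp_mem n _⟩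
  rw [LinearMap.mem_ker] at hρ
  refine LinearMap.mem_ker.2 (funext fun j => ?_)
  have h2 := congrArg (comp k a b c (n + 1)) (congrFun hρ j)
  simpa [D2_apply] using h2

end General

/-! ### Linear algebra of the relations -/

section Field

attribute [local irreducible] instRingSklyanin

variable {k : Type*} [Field k] {a b c : k}

/-- The nondegeneracy condition on the parameters of a Sklyanin algebra. -/
structure Nondegenerate (a b c : k) : Prop where
  left : ¬(a = 0 ∧ b = 0)
  mid : ¬(a = 0 ∧ c = 0)
  right : ¬(b = 0 ∧ c = 0)
  cube : ¬(a ^ 3 = b ^ 3 ∧ b ^ 3 = c ^ 3)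

theorem Nondegenerate.swap (h : Nondegenerate a b c) : Nondegenerate b a c :=
  ⟨fun h' => h.left h'.symm, h.right, h.mid, fun h' => h.cube ⟨h'.1.symm, h'.1.trans h'.2⟩⟩

/-- The coefficient matrix of the quadratic form `t₀ r₁ + t₁ r₂ + t₂ r₃`. -/
def T (a b c : k) (t : Fin 3 → k) : Matrix (Fin 3) (Fin 3) k :=
  !![c * t 0, a * t 2, b * t 1; b * t 2, c * t 1, a * t 0; a * t 1, b * t 0, c * t 2]

theorem vecMul_T (p t : Fin 3 → k) :
    Matrix.vecMul p (T a b c t) = Matrix.vecMul t (T b a c p) := by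
  ext j
  fin_cases j <;> simp [T, Matrix.vecMul, dotProduct, Fin.sum_univ_three] <;> ring

theorem T_sub_smul (p q : Fin 3 → k) (r : k) : T a b c (p - r • q) = T a b c p - r • T a b c q := by
  ext i j
  fin_cases i <;> fin_cases j <;> simp [T] <;> ring

/-- Nonzero combinations of the relations have rank at least two. -/
theorem Nondegenerate.exists_cross_ne_zero (h : Nondegenerate a b c) {t : Fin 3 → k} (ht : t ≠ 0) :
    ∃ i j, crossProduct (T a b c t i) (T a b c t j) ≠ 0 := by
  by_contra! H
  apply ht
  have e01 := H 0 1
  have e12 := H 1 2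
  have e20 := H 2 0
  simp only [crossProduct, T, LinearMap.mk₂_apply, Matrix.of_apply, Matrix.cons_val',
    Matrix.cons_val_zero, Matrix.cons_val_one, Matrix.cons_val, Matrix.cons_val_fin_one,
    Matrix.cons_eq_zero_iff] at e01 e12 e20
  obtain ⟨h1, h2, h3, -⟩ := e01
  obtain ⟨h4, h5, h6, -⟩ := e12
  obtain ⟨h7, h8, h9, -⟩ := e20
  have sq0 : ∀ r s u : k, r ≠ 0 → s ≠ 0 → r * s * u ^ 2 = 0 → u = 0 := by
    intro r s u hr hs hu
    simpa [hr, hs] using hu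
  have key : t 0 = 0 ∧ t 1 = 0 ∧ t 2 = 0 := by
    by_cases ha : a = 0
    · have hb : b ≠ 0 := fun hb => h.left ⟨ha, hb⟩
      have hc : c ≠ 0 := fun hc => h.mid ⟨ha, hc⟩
      subst ha
      exact ⟨sq0 b c _ hb hc (by linear_combination -h9),
        sq0 b c _ hb hc (by linear_combination -h1), sq0 b c _ hb hc (by linear_combination -h5)⟩
    by_cases hb : b = 0
    · have hc : c ≠ 0 := fun hc => h.right ⟨hb, hc⟩
      subst hb
      exact ⟨sq0 a c _ ha hc (by linear_combination -h2),
        sq0 a c _ ha hc (by linear_combination -h6), sq0 a c _ ha hc (by linear_combination -h7)⟩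
    by_cases hc : c = 0
    · subst hc
      exact ⟨sq0 a b _ ha hb (by linear_combination -h4),
        sq0 a b _ ha hb (by linear_combination -h8), sq0 a b _ ha hb (by linear_combination -h3)⟩
    have aux : ∀ u v w : k, a ^ 2 * (u * v) = b * c * w ^ 2 → b ^ 2 * (u * v) = a * c * w ^ 2 →
        c ^ 2 * (u * v) = a * b * w ^ 2 → w = 0 := by
      intro u v w e1 e2 e3
      by_cases huv : u * v = 0
      · exact sq0 b c w hb hc (by rw [← e1, huv, mul_zero])
      · refine absurd ⟨?_, ?_⟩ h.cube
        · exact mul_right_cancel₀ huv (by linear_combination a * e1 - b * e2)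
        · exact mul_right_cancel₀ huv (by linear_combination b * e2 - c * e3)
    exact ⟨aux (t 1) (t 2) _ (by linear_combination h9) (by linear_combination h2)
        (by linear_combination h4),
      aux (t 0) (t 2) _ (by linear_combination h1) (by linear_combination h6)
        (by linear_combination h8),
      aux (t 0) (t 1) _ (by linear_combination h5) (by linear_combination h7)
        (by linear_combination h3)⟩
  ext i
  fin_cases i
  exacts [key.1, key.2.1, key.2.2]

theorem exists_dotProduct_eq_one {p : Fin 3 → k} (hp : p ≠ 0) : ∃ e : Fin 3 → k, e ⬝ᵥ p = 1 := by
  obtain ⟨i, hi⟩ := Function.ne_iff.1 hp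
  exact ⟨Pi.single i (p i)⁻¹, by rw [single_dotProduct, inv_mul_cancel₀ hi]⟩

/-- Every point has a successor point. -/
theorem Nondegenerate.exists_succ_point (h : Nondegenerate a b c) {p : Fin 3 → k} (hp : p ≠ 0) :
    ∃ q : Fin 3 → k, q ≠ 0 ∧ ∀ f : Fin 3 → k, f ⬝ᵥ q = 0 →
      ∃ t, f = Matrix.vecMul p (T a b c t) := by
  obtain ⟨i, j, hij⟩ := h.swap.exists_cross_ne_zero hp
  obtain ⟨e, he⟩ := exists_dotProduct_eq_one hij
  refine ⟨_, hij, fun f hf => ⟨Pi.single i (f ⬝ᵥ crossProduct (T b a c p j) e) +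
    Pi.single j (f ⬝ᵥ crossProduct e (T b a c p i)), ?_⟩⟩
  rw [vecMul_T, Matrix.add_vecMul, Matrix.single_vecMul, Matrix.single_vecMul]
  change f = _ • T b a c p i + _ • T b a c p j
  generalize T b a c p i = u at *
  generalize T b a c p j = v at *
  have key : (e ⬝ᵥ crossProduct u v) • f = (f ⬝ᵥ crossProduct v e) • u +
      (f ⬝ᵥ crossProduct e u) • v + (f ⬝ᵥ crossProduct u v) • e := by
    ext m
    fin_cases m <;> simp [crossProduct, dotProduct, Fin.sum_univ_three] <;> ring
  rw [he, hf, one_smul, zero_smul, add_zero] at key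
  exact key

/-- A line meets the point cubic. -/
theorem exists_point_on_line [IsAlgClosed k] {l : Fin 3 → k} (hl : l ≠ 0) :
    ∃ p : Fin 3 → k, p ≠ 0 ∧ l ⬝ᵥ p = 0 ∧ (T a b c p).det = 0 := by
  have key : ∀ u v : Fin 3 → k, u ≠ 0 → (∀ s : k, v - s • u ≠ 0) → l ⬝ᵥ u = 0 → l ⬝ᵥ v = 0 →
      ∃ p : Fin 3 → k, p ≠ 0 ∧ l ⬝ᵥ p = 0 ∧ (T a b c p).det = 0 := by
    intro u v hu huv lu lv
    by_cases hdet : (T a b c u).det = 0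
    · exact ⟨u, hu, lu, hdet⟩
    obtain ⟨μ, hμ⟩ := Module.End.exists_eigenvalue
      (Matrix.toLin' ((T a b c u)⁻¹ * T a b c v))
    obtain ⟨x, hx⟩ := hμ.exists_hasEigenvector
    have h1 := hx.apply_eq_smul
    rw [Matrix.toLin'_apply] at h1
    refine ⟨v - μ • u, huv μ, by rw [dotProduct_sub, dotProduct_smul, lu, lv, smul_zero, sub_zero],
      Matrix.exists_mulVec_eq_zero_iff.1 ⟨x, hx.2, ?_⟩⟩
    have h2 := congrArg (Matrix.mulVec (T a b c u)) h1
    rw [Matrix.mulVec_mulVec, Matrix.mul_nonsing_inv_cancel_left _ _ (isUnit_iff_ne_zero.2 hdet),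
      Matrix.mulVec_smul] at h2
    rw [T_sub_smul, Matrix.sub_mulVec, h2, Matrix.smul_mulVec, sub_self]
  obtain ⟨i, hi⟩ := Function.ne_iff.1 hl
  refine key (Pi.single i (l (i + 1)) - Pi.single (i + 1) (l i))
    (Pi.single i (l (i + 2)) - Pi.single (i + 2) (l i)) ?_ ?_ ?_ ?_
  · refine Function.ne_iff.2 ⟨i + 1, ?_⟩
    fin_cases i <;> simpa using hi
  · refine fun s => Function.ne_iff.2 ⟨i + 2, ?_⟩
    fin_cases i <;> simpa using hi
  · simp [dotProduct_sub, mul_comm]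
  · simp [dotProduct_sub, mul_comm]

/-- Through a line passes a rank two combination of the relations. -/
theorem Nondegenerate.exists_rank_two [IsAlgClosed k] (h : Nondegenerate a b c)
    {l : Fin 3 → k} (hl : l ≠ 0) :
    ∃ p v m w t : Fin 3 → k, p ≠ 0 ∧ w ≠ 0 ∧
      (∀ f : Fin 3 → k, f ⬝ᵥ p = 0 → ∃ r s : k, f = r • l + s • v) ∧
      ∀ j, T a b c t j = l j • m + v j • w := by
  obtain ⟨p, hp, lp, hdet⟩ := exists_point_on_line (a := b) (b := a) (c := c) hl
  obtain ⟨t, ht, htp⟩ := Matrix.exists_vecMul_eq_zero_iff.2 hdet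
  rw [← vecMul_T] at htp
  obtain ⟨z, hz⟩ := exists_dotProduct_eq_one hl
  obtain ⟨e₀, he₀⟩ := exists_dotProduct_eq_one hp
  obtain ⟨e, ez, ep⟩ : ∃ e : Fin 3 → k, e ⬝ᵥ z = 0 ∧ e ⬝ᵥ p = 1 := by
    refine ⟨e₀ - (e₀ ⬝ᵥ z) • l, ?_, ?_⟩
    · rw [sub_dotProduct, smul_dotProduct, dotProduct_comm l z, hz, smul_eq_mul, mul_one, sub_self]
    · rw [sub_dotProduct, smul_dotProduct, lp, he₀, smul_zero, sub_zero]
  rw [dotProduct_comm] at hz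
  set v := crossProduct z p with hv
  set u := crossProduct l e with hu
  have vz : v ⬝ᵥ z = 0 := by rw [dotProduct_comm]; exact dot_self_cross z p
  have vp : v ⬝ᵥ p = 0 := by rw [dotProduct_comm]; exact dot_cross_self z p
  have lu : l ⬝ᵥ u = 0 := dot_self_cross l e
  have eu : e ⬝ᵥ u = 0 := dot_cross_self l e
  have vu : v ⬝ᵥ u = 1 := by
    rw [hv, hu, cross_dot_cross, dotProduct_comm z l, dotProduct_comm p e, hz, ep,
      dotProduct_comm z e, ez]
    ring
  have hinv : Matrix.of ![l, v, e] * (Matrix.of ![z, u, p]).transpose = 1 := by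
    ext i j
    change ![l, v, e] i ⬝ᵥ ![z, u, p] j = _
    fin_cases i <;> fin_cases j
    exacts [hz, lu, lp, vz, vu, vp, ez, eu, ep]
  rw [mul_eq_one_comm] at hinv
  have hid : ∀ i j, z i * l j + u i * v j + p i * e j = (1 : Matrix (Fin 3) (Fin 3) k) i j := by
    intro i j
    rw [← hinv]
    simp [Matrix.mul_apply, Fin.sum_univ_three]
  have hT : ∀ j, T a b c t j = l j • Matrix.vecMul z (T a b c t) +
      v j • Matrix.vecMul u (T a b c t) := by
    intro j
    ext n
    have h1 : T a b c t j n = ∑ i, (1 : Matrix (Fin 3) (Fin 3) k) i j * T a b c t i n := by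
      simp [Matrix.one_apply]
    have h2 := congrFun htp n
    rw [h1]
    simp only [← hid, Matrix.vecMul, dotProduct, Fin.sum_univ_three, Pi.add_apply, Pi.smul_apply,
      smul_eq_mul, Pi.zero_apply] at h2 ⊢
    linear_combination e j * h2
  refine ⟨p, v, _, _, t, hp, ?_, ?_, hT⟩
  · intro hw
    obtain ⟨i, j, hij⟩ := h.exists_cross_ne_zero ht
    apply hij
    rw [hT i, hT j, hw]
    simp
  · intro f hf
    refine ⟨f ⬝ᵥ z, f ⬝ᵥ u, ?_⟩
    ext j
    have h1 : f j = ∑ i, f i * (1 : Matrix (Fin 3) (Fin 3) k) i j := by simp [Matrix.one_apply]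
    rw [h1]
    simp only [← hid, dotProduct, Fin.sum_univ_three, Pi.add_apply, Pi.smul_apply,
      smul_eq_mul] at hf ⊢
    linear_combination e j * hf

/-! ### Dimensions of the graded pieces -/

variable (k a b c) in
/-- The linear form with the given coefficients. -/
def lin : (Fin 3 → k) →ₗ[k] Sklyanin k a b c := Fintype.linearCombination k (gen k a b c)

theorem lin_apply (f : Fin 3 → k) : lin k a b c f = ∑ i, f i • gen k a b c i := rfl

theorem lin_single (i : Fin 3) : lin k a b c (Pi.single i 1) = gen k a b c i := by
  rw [lin, Fintype.linearCombination_apply_single, one_smul]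

theorem lin_mem_V (f : Fin 3 → k) : lin k a b c f ∈ V k a b c := by
  rw [lin_apply]
  exact Submodule.sum_mem _ fun i _ => Submodule.smul_mem _ _ (gen_mem_V i)

theorem V_mul_G_le (n : ℕ) : V k a b c * G k a b c n ≤ G k a b c (n + 1) :=
  V_mul_le.2 fun i _ hs => gen_mul_mem_G i hs

theorem sum_gen_mul_lin_T (t : Fin 3 → k) :
    ∑ j, gen k a b c j * lin k a b c (T a b c t j) = 0 := by
  have h0 := gen_rel (a := a) (b := b) (c := c) 0
  have h1 := gen_rel (a := a) (b := b) (c := c) 1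
  have h2 := gen_rel (a := a) (b := b) (c := c) 2
  simp only [Fin.isValue, zero_add, show (1 : Fin 3) + 1 = 2 from rfl,
    show (1 : Fin 3) + 2 = 0 from rfl, show (2 : Fin 3) + 1 = 0 from rfl,
    show (2 : Fin 3) + 2 = 1 from rfl] at h0 h1 h2
  simp only [T, lin_apply, Fin.sum_univ_three, mul_add, mul_smul_comm, Matrix.of_apply,
    Matrix.cons_val', Matrix.cons_val_zero, Matrix.cons_val_one, Matrix.cons_val,
    Matrix.cons_val_fin_one]
  have key := congrArg₂ (· + ·) (congrArg₂ (· + ·) (congrArg (t 0 • ·) h0) (congrArg (t 1 • ·) h1))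
    (congrArg (t 2 • ·) h2)
  simp only [smul_zero, add_zero] at key
  rw [← key]
  module

variable (k a b c) in
/-- The linear forms vanishing at a point. -/
def P (p : Fin 3 → k) : Submodule k (Sklyanin k a b c) :=
  (LinearMap.ker (Fintype.linearCombination k p)).map (lin k a b c)

theorem lin_mem_P {p f : Fin 3 → k} (h : f ⬝ᵥ p = 0) : lin k a b c f ∈ P k a b c p :=
  Submodule.mem_map_of_mem (LinearMap.mem_ker.2 h)

theorem Nondegenerate.exists_le_P_mul_sup (h : Nondegenerate a b c) (n : ℕ) {p : Fin 3 → k}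
    (hp : p ≠ 0) :
    ∃ u, G k a b c (n + 2) ≤ P k a b c p * G k a b c (n + 1) ⊔ Submodule.span k {u} := by
  induction n generalizing p with
  | zero =>
    refine ⟨1, le_sup_of_le_right ?_⟩
    change V k a b c ^ 0 ≤ _
    rw [pow_zero, Submodule.one_le]
    exact Submodule.mem_span_singleton_self _
  | succ n ih =>
    obtain ⟨e, he⟩ := exists_dotProduct_eq_one hp
    obtain ⟨q, hq, hpq⟩ := h.exists_succ_point hp
    obtain ⟨u, hu⟩ := ih hq
    have hgen : ∀ j, gen k a b c j = lin k a b c (Pi.single j 1 - p j • e) +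
        p j • lin k a b c e := by
      intro j
      rw [map_sub, map_smul, lin_single, sub_add_cancel]
    have hmem : ∀ j, lin k a b c (Pi.single j 1 - p j • e) ∈ P k a b c p := by
      intro j
      apply lin_mem_P
      rw [sub_dotProduct, smul_dotProduct, he, single_dotProduct, one_mul, smul_eq_mul, mul_one,
        sub_self]
    have hmul : ∀ x ∈ P k a b c q, lin k a b c e * x ∈ P k a b c p * V k a b c := by
      rintro _ ⟨f, hf, rfl⟩
      obtain ⟨t, rfl⟩ := hpq f hf
      have h1 : lin k a b c (Matrix.vecMul p (T a b c t)) =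
          ∑ j, p j • lin k a b c (T a b c t j) := by
        rw [Matrix.vecMul_eq_sum, map_sum]
        simp only [map_smul]
      have h2 := sum_gen_mul_lin_T (a := a) (b := b) (c := c) t
      have h3 : lin k a b c e * lin k a b c (Matrix.vecMul p (T a b c t)) =
          -∑ j, lin k a b c (Pi.single j 1 - p j • e) * lin k a b c (T a b c t j) := by
        rw [eq_neg_iff_add_eq_zero, ← h2, h1, Finset.mul_sum, ← Finset.sum_add_distrib]
        refine Finset.sum_congr rfl fun j _ => ?_
        conv_rhs => rw [hgen j]
        rw [add_mul, mul_smul_comm, smul_mul_assoc, add_comm]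
      rw [h3]
      exact neg_mem (Submodule.sum_mem _ fun j _ => Submodule.mul_mem_mul (hmem j) (lin_mem_V _))
    have hle : G k a b c (n + 2) ≤ (P k a b c p * G k a b c (n + 2) ⊔
        Submodule.span k {lin k a b c e * u}).comap (LinearMap.mulLeft k (lin k a b c e)) := by
      refine hu.trans (sup_le (Submodule.mul_le.2 fun x hx y hy => ?_) ?_)
      · rw [Submodule.mem_comap, LinearMap.mulLeft_apply, ← mul_assoc]
        refine Submodule.mem_sup_left ?_
        have := Submodule.mul_mem_mul (hmul x hx) hy
        rw [mul_assoc] at this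
        exact mul_le_mul_right (V_mul_G_le _) _ this
      · rw [Submodule.span_le, Set.singleton_subset_iff]
        exact Submodule.mem_sup_right (Submodule.mem_span_singleton_self _)
    refine ⟨lin k a b c e * u, ?_⟩
    change V k a b c ^ (n + 1) ≤ _
    rw [pow_succ', V_mul_le]
    intro j s hs
    rw [hgen j, add_mul, smul_mul_assoc]
    exact Submodule.add_mem _ (Submodule.mem_sup_left (Submodule.mul_mem_mul (hmem j) hs))
      (Submodule.smul_mem _ _ (hle hs))

instance finite_G (n : ℕ) : FiniteDimensional k (G k a b c n) := by
  match n with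
  | 0 | 1 => exact inferInstanceAs (FiniteDimensional k (⊥ : Submodule k (Sklyanin k a b c)))
  | n + 2 =>
    exact Module.Finite.iff_fg.2 ((Submodule.fg_span (Set.finite_range _)).pow n)

theorem Nondegenerate.exists_le_map_lin_sup [IsAlgClosed k] (h : Nondegenerate a b c) (n : ℕ)
    {l : Fin 3 → k} (hl : l ≠ 0) :
    ∃ U : Submodule k (Sklyanin k a b c), U.FG ∧ Module.finrank k U ≤ n + 1 ∧
      G k a b c (n + 2) ≤
        (G k a b c (n + 1)).map (LinearMap.mulLeft k (lin k a b c l)) ⊔ U := by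
  induction n generalizing l with
  | zero =>
    refine ⟨Submodule.span k {1}, Submodule.fg_span_singleton _, ?_, le_sup_of_le_right ?_⟩
    · exact (finrank_span_le_card _).trans (by simp)
    · change V k a b c ^ 0 ≤ _
      rw [pow_zero, Submodule.one_le]
      exact Submodule.mem_span_singleton_self _
  | succ n ih =>
    obtain ⟨p, v, m, w, t, hp, hw, hpl, ht⟩ := h.exists_rank_two hl
    obtain ⟨U, hU, hU', hle⟩ := ih hw
    obtain ⟨u, hu⟩ := h.exists_le_P_mul_sup (n + 1) hp
    have : FiniteDimensional k U := Module.Finite.iff_fg.2 hU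
    refine ⟨U.map (LinearMap.mulLeft k (lin k a b c v)) ⊔ Submodule.span k {u},
      (hU.map _).sup (Submodule.fg_span_singleton _), ?_, ?_⟩
    · have h1 := Submodule.finrank_add_le_finrank_add_finrank
        (U.map (LinearMap.mulLeft k (lin k a b c v))) (Submodule.span k {u})
      have h2 := Submodule.finrank_map_le (LinearMap.mulLeft k (lin k a b c v)) U
      have h3 : Module.finrank k (Submodule.span k {u}) ≤ 1 :=
        (finrank_span_le_card _).trans (by simp)
      omega
    have hrel : lin k a b c v * lin k a b c w = -(lin k a b c l * lin k a b c m) := by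
      rw [eq_neg_iff_add_eq_zero, ← sum_gen_mul_lin_T (a := a) (b := b) (c := c) t]
      simp only [ht, map_add, map_smul, mul_add, mul_smul_comm, Finset.sum_add_distrib,
        ← smul_mul_assoc, ← Finset.sum_mul, ← lin_apply]
      rw [add_comm]
    have hv : G k a b c (n + 2) ≤ ((G k a b c (n + 2)).map (LinearMap.mulLeft k (lin k a b c l)) ⊔
        U.map (LinearMap.mulLeft k (lin k a b c v))).comap
          (LinearMap.mulLeft k (lin k a b c v)) := by
      refine hle.trans (sup_le ?_ ?_)
      · rintro _ ⟨y, hy, rfl⟩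
        rw [Submodule.mem_comap, LinearMap.mulLeft_apply, LinearMap.mulLeft_apply, ← mul_assoc,
          hrel, neg_mul, mul_assoc]
        exact neg_mem (Submodule.mem_sup_left (Submodule.mem_map_of_mem
          (V_mul_G_le _ (Submodule.mul_mem_mul (lin_mem_V _) hy))))
      · exact Submodule.map_le_iff_le_comap.1 le_sup_right
    refine hu.trans ?_
    rw [← sup_assoc]
    refine sup_le_sup_right (Submodule.mul_le.2 ?_) _
    rintro _ ⟨f, hf, rfl⟩ y hy
    obtain ⟨r, s, rfl⟩ := hpl f hf
    rw [map_add, map_smul, map_smul, add_mul, smul_mul_assoc, smul_mul_assoc]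
    exact Submodule.add_mem _ (Submodule.smul_mem _ _ (Submodule.mem_sup_left
      (Submodule.mem_map_of_mem hy))) (Submodule.smul_mem _ _ (hv hy))

variable (k a b c) in
/-- Triples of homogeneous elements as functions into the graded piece. -/
def equivW (n : ℕ) : W k a b c n ≃ₗ[k] (Fin 3 → G k a b c n) where
  toFun σ i := ⟨σ.1 i, mem_W.1 σ.2 i⟩
  invFun σ := ⟨fun i => (σ i).1, mem_W.2 fun i => (σ i).2⟩
  map_add' _ _ := rfl
  map_smul' _ _ := rfl
  left_inv _ := rfl
  right_inv _ := rfl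

theorem finrank_W (n : ℕ) :
    Module.finrank k (W k a b c n) = 3 * Module.finrank k (G k a b c n) := by
  rw [(equivW k a b c n).finrank_eq, Module.finrank_pi_fintype, Finset.sum_const, Finset.card_univ,
    Fintype.card_fin, smul_eq_mul]

instance finite_W (n : ℕ) : FiniteDimensional k (W k a b c n) :=
  Module.Finite.equiv (equivW k a b c n).symm

theorem finrank_map_add_finrank_ker_inf {M N : Type*} [AddCommGroup M] [Module k M]
    [AddCommGroup N] [Module k N] (f : M →ₗ[k] N) (S : Submodule k M) [FiniteDimensional k S] :
    Module.finrank k (S.map f) + Module.finrank k (LinearMap.ker f ⊓ S : Submodule k M) =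
      Module.finrank k S := by
  have h1 := LinearMap.finrank_range_add_finrank_ker (f.domRestrict S)
  rw [LinearMap.range_domRestrict] at h1
  have h2 := (Submodule.equivSubtypeMap S (LinearMap.ker (f.domRestrict S))).finrank_eq
  rw [LinearMap.ker_domRestrict, Submodule.map_comap_subtype, inf_comm] at h2
  rw [← h1, LinearMap.ker_domRestrict, h2]

theorem finrank_G_two : Module.finrank k (G k a b c 2) = 1 := by
  change Module.finrank k ((V k a b c ^ 0 : Submodule k (Sklyanin k a b c))) = 1
  rw [pow_zero, Submodule.one_eq_span]
  refine finrank_span_singleton fun h => ?_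
  simpa using congrArg (aug k a b c) h

theorem Nondegenerate.finrank_G_le [IsAlgClosed k] (h : Nondegenerate a b c) (n : ℕ) :
    Module.finrank k (G k a b c (n + 2)) ≤ Module.finrank k
      ((G k a b c (n + 1)).map (LinearMap.mulLeft k (gen k a b c 0))) + (n + 1) := by
  obtain ⟨U, hU, hU', hle⟩ := h.exists_le_map_lin_sup n (l := Pi.single 0 1) (by simp)
  have : FiniteDimensional k U := Module.Finite.iff_fg.2 hU
  rw [lin_single] at hle
  have h1 := Submodule.finrank_mono hle
  have h2 := Submodule.finrank_add_le_finrank_add_finrank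
    ((G k a b c (n + 1)).map (LinearMap.mulLeft k (gen k a b c 0))) U
  omega

theorem Nondegenerate.choose_le_finrank_map_D3 [IsAlgClosed k] (h : Nondegenerate a b c) (n : ℕ)
    (hn : (n + 1).choose 2 ≤ Module.finrank k (G k a b c (n + 1))) :
    n.choose 2 ≤ Module.finrank k ((G k a b c n).map (D3 k a b c)) := by
  cases n with
  | zero => simp
  | succ n =>
    have h1 := h.finrank_G_le n
    replace hn : (n + 2).choose 2 ≤ Module.finrank k (G k a b c (n + 2)) := hn
    have h3 : (G k a b c (n + 1)).map (LinearMap.mulLeft k (gen k a b c 0)) =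
        ((G k a b c (n + 1)).map (D3 k a b c)).map (LinearMap.proj 0) := by
      rw [← Submodule.map_comp]
      rfl
    have h4 := Submodule.finrank_map_le
      (LinearMap.proj 0 : (Fin 3 → Sklyanin k a b c) →ₗ[k] Sklyanin k a b c)
      ((G k a b c (n + 1)).map (D3 k a b c))
    rw [← h3] at h4
    have h5 := Nat.choose_succ_succ (n + 1) 1
    rw [Nat.choose_one_right] at h5
    simp only [Nat.succ_eq_add_one, Nat.reduceAdd, add_assoc] at h5
    omega

theorem finrank_complex (n : ℕ) :
    Module.finrank k (G k a b c (n + 3)) + 3 * Module.finrank k (G k a b c (n + 1)) =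
      3 * Module.finrank k (G k a b c (n + 2)) +
        Module.finrank k (LinearMap.ker (D2 k a b c) ⊓ W k a b c (n + 1) :
          Submodule k (Fin 3 → Sklyanin k a b c)) := by
  have h1 := finrank_map_add_finrank_ker_inf (D1 k a b c) (W k a b c (n + 2))
  have h2 := finrank_map_add_finrank_ker_inf (D2 k a b c) (W k a b c (n + 1))
  rw [map_D1_W, finrank_W] at h1
  rw [map_D2_W, finrank_W] at h2
  omega

/-- The Hilbert series is that of a polynomial ring in three variables. -/
theorem Nondegenerate.finrank_G [IsAlgClosed k] (h : Nondegenerate a b c) (n : ℕ) :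
    Module.finrank k (G k a b c n) = n.choose 2 := by
  induction n using Nat.strong_induction_on with
  | _ n ih =>
    match n with
    | 0 | 1 => exact finrank_bot k (Sklyanin k a b c)
    | 2 => exact finrank_G_two
    | n + 3 =>
      have e0 := ih n (by omega)
      have e1 := ih (n + 1) (by omega)
      have e2 := ih (n + 2) (by omega)
      have h1 := finrank_complex (a := a) (b := b) (c := c) n
      have h2 := (h.choose_le_finrank_map_D3 n e1.ge).trans
        (Submodule.finrank_mono (map_D3_G_le n))
      have h3 : Module.finrank k (G k a b c (n + 3)) ≤ Module.finrank k
          ((G k a b c (n + 2)).map (LinearMap.mulLeft k (gen k a b c 0))) + (n + 2) :=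
        h.finrank_G_le (n + 1)
      have h5 := Submodule.finrank_map_le
        (LinearMap.mulLeft k (gen k a b c 0)) (G k a b c (n + 2))
      have c1 := Nat.choose_succ_succ n 1
      have c2 := Nat.choose_succ_succ (n + 1) 1
      have c3 := Nat.choose_succ_succ (n + 2) 1
      simp only [Nat.succ_eq_add_one, Nat.reduceAdd, Nat.choose_one_right, add_assoc] at c1 c2 c3
      omega

theorem Nondegenerate.ker_D2_le [IsAlgClosed k] (h : Nondegenerate a b c) :
    LinearMap.ker (D2 k a b c) ≤ LinearMap.range (D3 k a b c) := by
  refine ker_D2_le_of_homogeneous fun n => ?_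
  cases n with
  | zero =>
    rintro ρ ⟨-, hρ⟩
    rw [show ρ = 0 from funext fun i => (Submodule.mem_bot k).1 (mem_W.1 hρ i)]
    exact Submodule.zero_mem _
  | succ n =>
    rw [← Submodule.eq_of_le_of_finrank_le (map_D3_G_le (a := a) (b := b) (c := c) n) ?_]
    · exact LinearMap.map_le_range
    · have h1 := finrank_complex (a := a) (b := b) (c := c) n
      have h2 := h.choose_le_finrank_map_D3 n (h.finrank_G (n + 1)).ge
      rw [h.finrank_G, h.finrank_G, h.finrank_G] at h1
      have c1 := Nat.choose_succ_succ n 1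
      have c2 := Nat.choose_succ_succ (n + 1) 1
      have c3 := Nat.choose_succ_succ (n + 2) 1
      simp only [Nat.succ_eq_add_one, Nat.reduceAdd, Nat.choose_one_right, add_assoc] at c1 c2 c3
      omega

end Field

/-! ### Specialization of the coefficients -/

section Specialization

attribute [local irreducible] instRingSklyanin

variable {R K : Type*} [CommRing R] [CommRing K] {a b c : R} (φ : R →+* K)

variable (a b c) in
/-- Specialization of the Sklyanin algebra along a ring homomorphism. -/
def specialize : Sklyanin R a b c →+* Sklyanin K (φ a) (φ b) (φ c) :=
  letI : Algebra R (Sklyanin K (φ a) (φ b) (φ c)) := Algebra.compHom _ φ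
  (lift (gen K (φ a) (φ b) (φ c)) (fun i => gen_rel i) :
    Sklyanin R a b c →ₐ[R] Sklyanin K (φ a) (φ b) (φ c)).toRingHom

@[simp]
theorem specialize_gen (i : Fin 3) :
    specialize a b c φ (gen R a b c i) = gen K (φ a) (φ b) (φ c) i :=
  letI : Algebra R (Sklyanin K (φ a) (φ b) (φ c)) := Algebra.compHom _ φ
  lift_gen (k := R) (a := a) (b := b) (c := c) (gen K (φ a) (φ b) (φ c)) (fun i => gen_rel i) i

@[simp]
theorem specialize_algebraMap (r : R) :
    specialize a b c φ (algebraMap R _ r) = algebraMap K _ (φ r) :=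
  letI : Algebra R (Sklyanin K (φ a) (φ b) (φ c)) := Algebra.compHom _ φ
  (lift (gen K (φ a) (φ b) (φ c)) (fun i => gen_rel i) :
    Sklyanin R a b c →ₐ[R] Sklyanin K (φ a) (φ b) (φ c)).commutes r

@[simp]
theorem specialize_smul (r : R) (s : Sklyanin R a b c) :
    specialize a b c φ (r • s) = φ r • specialize a b c φ s := by
  rw [Algebra.smul_def, map_mul, specialize_algebraMap, ← Algebra.smul_def]

variable {φ}

theorem specialize_surjective (hφ : Function.Surjective φ) :
    Function.Surjective (specialize a b c φ) := by
  let M : Submodule K (Sklyanin K (φ a) (φ b) (φ c)) :=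
    { (specialize a b c φ).range.toAddSubgroup.toAddSubmonoid with
      smul_mem' := by
        rintro x _ ⟨s, rfl⟩
        obtain ⟨r, rfl⟩ := hφ x
        exact ⟨r • s, specialize_smul φ r s⟩ }
  refine fun s => mem_of_gen_mul_mem M ⟨1, map_one _⟩ ?_ s
  rintro i _ ⟨s, rfl⟩
  exact ⟨gen R a b c i * s, by rw [map_mul, specialize_gen]⟩

theorem exists_smul_of_specialize_eq_zero (hφ : Function.Surjective φ) {t : R}
    (ht : RingHom.ker φ = Ideal.span {t}) {s : Sklyanin R a b c}
    (hs : specialize a b c φ s = 0) : ∃ s', s = t • s' := by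
  let I : Ideal (Sklyanin R a b c) := Ideal.span {algebraMap R _ t}
  have hI : ∀ x, x ∈ I ↔ ∃ s', x = t • s' := by
    intro x
    rw [Ideal.mem_span_singleton']
    refine exists_congr fun s' => ?_
    rw [eq_comm, Algebra.smul_def, Algebra.commutes]
  have : I.IsTwoSided := ⟨by
    intro x y hx
    rw [hI] at hx ⊢
    obtain ⟨s', rfl⟩ := hx
    exact ⟨s' * y, smul_mul_assoc _ _ _⟩⟩
  let π : Sklyanin R a b c →+* Sklyanin R a b c ⧸ I := Ideal.Quotient.mk I
  let ψ : K →+* Sklyanin R a b c ⧸ I := φ.liftOfSurjective hφ ⟨π.comp (algebraMap R _), by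
    rw [ht, Ideal.span_singleton_le_iff_mem]
    exact Ideal.Quotient.eq_zero_iff_mem.2 (Ideal.mem_span_singleton_self _)⟩
  have hψ : ∀ r, ψ (φ r) = π (algebraMap R _ r) := RingHom.liftOfSurjective_comp_apply φ hφ _
  let : Algebra K (Sklyanin R a b c ⧸ I) := ψ.toAlgebra' (by
    intro x y
    obtain ⟨r, rfl⟩ := hφ x
    obtain ⟨y, rfl⟩ := Ideal.Quotient.mk_surjective y
    rw [hψ]
    exact (map_mul π _ _).symm.trans ((congrArg π (Algebra.commutes r y)).trans (map_mul π _ _)))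
  have hsmul : ∀ r s, φ r • π s = π (r • s) := by
    intro r s
    rw [Algebra.smul_def, Algebra.smul_def, map_mul, ← hψ]
    rfl
  let g : Sklyanin K (φ a) (φ b) (φ c) →ₐ[K] Sklyanin R a b c ⧸ I :=
    lift (fun i => π (gen R a b c i)) (by
      intro i
      simp only [← map_mul, hsmul, ← map_add]
      rw [gen_rel, map_zero])
  let M : Submodule R (Sklyanin R a b c) :=
    { ((g : _ →+* _).comp (specialize a b c φ)).eqLocus π |>.toAddSubgroup.toAddSubmonoid with
      smul_mem' := by
        intro r s hs
        change g (specialize a b c φ (r • s)) = π (r • s)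
        rw [specialize_smul, map_smul, ← hsmul]
        exact congrArg (φ r • ·) hs }
  have hM : s ∈ M := by
    refine mem_of_gen_mul_mem M ?_ ?_ s
    · change g (specialize a b c φ 1) = π 1
      rw [map_one, map_one, map_one]
    intro i s hs
    change g (specialize a b c φ (gen R a b c i * s)) = π (gen R a b c i * s)
    rw [map_mul, map_mul, map_mul, specialize_gen, lift_gen]
    exact congrArg (π (gen R a b c i) * ·) hs
  rw [← hI, ← Ideal.Quotient.eq_zero_iff_mem]
  refine Eq.trans (Eq.symm hM) ?_
  change g (specialize a b c φ s) = 0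
  rw [hs, map_zero]

theorem specialize_D2 (ρ : Fin 3 → Sklyanin R a b c) (j : Fin 3) :
    specialize a b c φ (D2 R a b c ρ j) =
      D2 K (φ a) (φ b) (φ c) (fun i => specialize a b c φ (ρ i)) j := by
  simp [D2_apply]

/-- A regular parameter remains regular if the complex of the specialization is exact. -/
theorem eq_zero_of_smul_eq_zero (hφ : Function.Surjective φ) {t : R}
    (hker : RingHom.ker φ = Ideal.span {t}) (ht : ∀ r, t * r = 0 → r = 0)
    (hD2 : LinearMap.ker (D2 K (φ a) (φ b) (φ c)) ≤ LinearMap.range (D3 K (φ a) (φ b) (φ c)))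
    {s : Sklyanin R a b c} (hs : t • s = 0) : s = 0 := by
  refine eq_zero_of_forall_exists_D1 {s | t • s = 0} (fun s hs => ?_) s hs
  change t • s = 0 at hs
  obtain ⟨r, σ, rfl⟩ := exists_eq_add_D1 s
  have hr : r = 0 := by
    have h := congrArg (aug R a b c) hs
    rw [map_smul, map_add, aug_D1, map_zero, add_zero, AlgHom.commutes] at h
    exact ht r h
  subst hr
  rw [map_zero, zero_add, ← map_smul] at hs
  obtain ⟨ρ, hρ⟩ := exists_D2_eq hs
  have hφt : φ t = 0 := by
    rw [← RingHom.mem_ker, hker]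
    exact Ideal.mem_span_singleton_self t
  obtain ⟨τ', hτ'⟩ := hD2 (x := fun i => specialize a b c φ (ρ i)) (funext fun j => by
    rw [← specialize_D2, hρ, Pi.smul_apply, specialize_smul, hφt, zero_smul, Pi.zero_apply])
  obtain ⟨τ, rfl⟩ := specialize_surjective hφ τ'
  have h : ∀ i, ∃ s', ρ i - gen R a b c i * τ = t • s' := fun i => by
    refine exists_smul_of_specialize_eq_zero hφ hker ?_
    rw [map_sub, map_mul, specialize_gen, sub_eq_zero]
    exact (congrFun hτ' i).symm
  choose ρ' hρ' using h
  have hρ2 : ρ = D3 R a b c τ + t • ρ' := by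
    ext i
    rw [Pi.add_apply, Pi.smul_apply, ← hρ', D3_apply, add_sub_cancel]
  rw [hρ2, map_add, D2_D3, zero_add, map_smul] at hρ
  refine ⟨σ - D2 R a b c ρ', fun i => ?_, ?_⟩
  · change t • (σ i - D2 R a b c ρ' i) = 0
    rw [smul_sub, sub_eq_zero]
    exact (congrFun hρ i).symm
  · rw [map_sub, D1_D2, sub_zero, map_zero, zero_add]

end Specialization

end Sklyanin

open Polynomial in
/-- In the extended formal Sklyanin algebra `S_ħ` — the quotient of the free algebra over
`k[ħ]` on `x, y, z` by the relations with coefficients `ã = a+αħ`, `b̃ = b+βħ`,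
`c̃ = c+γħ` — the element `ħ − d` is regular whenever the specialized parameters
`(a+αd, b+βd, c+γd)` have no two coordinates simultaneously zero and do not satisfy
`a'³ = b'³ = c'³`. -/
theorem formal_sklyanin_hbar_sub_d_regular
    (k : Type*) [Field k] [IsAlgClosed k] [CharZero k]
    (a b c α β γ : k) (habc : a * b * c ≠ 0)
    (hdeg : (3 * a * b * c) ^ 3 ≠ (a ^ 3 + b ^ 3 + c ^ 3) ^ 3)
    (hαβγ : ¬(α = 0 ∧ β = 0 ∧ γ = 0))
    (d : k)
    (h12 : ¬(a + α * d = 0 ∧ b + β * d = 0))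
    (h13 : ¬(a + α * d = 0 ∧ c + γ * d = 0))
    (h23 : ¬(b + β * d = 0 ∧ c + γ * d = 0))
    (hcube : ¬((a + α * d) ^ 3 = (b + β * d) ^ 3 ∧ (b + β * d) ^ 3 = (c + γ * d) ^ 3)) :
    (∀ s : Sklyanin (Polynomial k) (C a + C α * X) (C b + C β * X) (C c + C γ * X),
      algebraMap (Polynomial k) _ (X - C d) * s = 0 → s = 0) ∧
    (∀ s : Sklyanin (Polynomial k) (C a + C α * X) (C b + C β * X) (C c + C γ * X),
      s * algebraMap (Polynomial k) _ (X - C d) = 0 → s = 0) := by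
  have hφ : Function.Surjective (evalRingHom d) := fun x => ⟨C x, by simp⟩
  have hker : RingHom.ker (evalRingHom d) = Ideal.span {X - C d} := Polynomial.ker_evalRingHom d
  have hnd : Sklyanin.Nondegenerate (evalRingHom d (C a + C α * X)) (evalRingHom d (C b + C β * X))
      (evalRingHom d (C c + C γ * X)) := by
    simp only [coe_evalRingHom, eval_add, eval_mul, eval_C, eval_X]
    exact ⟨h12, h13, h23, hcube⟩
  have key : ∀ s : Sklyanin (Polynomial k) (C a + C α * X) (C b + C β * X) (C c + C γ * X),
      algebraMap (Polynomial k) _ (X - C d) * s = 0 → s = 0 := by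
    intro s hs
    rw [← Algebra.smul_def] at hs
    exact Sklyanin.eq_zero_of_smul_eq_zero hφ hker
      (fun r hr => (mul_eq_zero.1 hr).resolve_left (X_sub_C_ne_zero d)) hnd.ker_D2_le hs
  exact ⟨key, fun s hs => key s ((Algebra.commutes _ s).trans hs)⟩

end
end

section
/- Let m ≥ 1 be an integer and n = 3m, let α, μ ∈ k be nonzero, set ℓ := α(z₁+z₂+z₃), Φ := ℓ³ − μ·z₁z₂z₃ ∈ k[z₁,z₂,z₃], and assume the only common zero in k³ of ∂Φ/∂z₁, ∂Φ/∂z₂, ∂Φ/∂z₃ is (0,0,0). Set F := g^{3m} + 3ℓ·g^{2m} + 3ℓ²·g^{m} + Φ ∈ k[z₁,z₂,z₃,g]. Then the set of points p ∈ k⁴ at which F, ∂F/∂z₁, ∂F/∂z₂, ∂F/∂z₃ all vanish equals the set of points at which F and all four partial derivatives (including ∂F/∂g) vanish, and both equal the union C₁ ∪ C₂ ∪ C₃ of the three curves C_i := {(p₁,p₂,p₃,p₄) ∈ k⁴ : p₄^m + α·p_i = 0 and p_j = 0 for both j ∈ {1,2,3} with j ≠ i}. (In other words, the singular locus of the affine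 hypersurface Y = V(F) ⊂ A⁴ is the union of these three dilation-invariant curves meeting at the origin.) -/
open MvPolynomial

/-- If `w ^ 3 - μ * x * y * z` and its partial derivatives in `x, y, z` vanish, where `w` has
partial derivatives `α`, then `w = 0`, except for the degenerate value `μ = 27 * α ^ 3`. -/
lemma eq_zero_of_cube_eq_of_sq_eq {k : Type*} [Field k] [CharZero k] {α μ x y z w : k}
    (hμ : 27 * α ^ 3 ≠ μ) (h : w ^ 3 = μ * (x * y * z))
    (hx : 3 * α * w ^ 2 = μ * (y * z)) (hy : 3 * α * w ^ 2 = μ * (x * z))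
    (hz : 3 * α * w ^ 2 = μ * (x * y)) : w = 0 := by
  by_contra hw
  have hw2 : w ^ 2 ≠ 0 := pow_ne_zero 2 hw
  have ey : w = 3 * α * y := mul_left_cancel₀ hw2 (by linear_combination h - y * hy)
  have ez : w = 3 * α * z := mul_left_cancel₀ hw2 (by linear_combination h - z * hz)
  refine hμ (mul_right_cancel₀ hw2 ?_)
  linear_combination 9 * α ^ 2 * hx - μ * w * ey - 3 * α * y * μ * ez

lemma add_mul_sum_eq_zero_and_iff {k : Type*} [Field k] {a α x y z : k} :
    (a + α * (x + y + z) = 0 ∧ y * z = 0 ∧ x * z = 0 ∧ x * y = 0) ↔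
      ((a + α * x = 0 ∧ y = 0 ∧ z = 0) ∨ (a + α * y = 0 ∧ x = 0 ∧ z = 0)) ∨
        (a + α * z = 0 ∧ x = 0 ∧ y = 0) := by
  grind

lemma eval_cube_add_sub_prod {k : Type*} [Field k] (m : ℕ) (α μ : k) (p : Fin 4 → k) :
    eval p ((X 3 ^ m + C α * (X 0 + X 1 + X 2)) ^ 3 - C μ * (X 0 * X 1 * X 2)) =
      (p 3 ^ m + α * (p 0 + p 1 + p 2)) ^ 3 - μ * (p 0 * p 1 * p 2) := by
  simp

lemma eval_pderiv_cube_add_sub_prod {k : Type*} [Field k] (m : ℕ) (α μ : k) (p : Fin 4 → k)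
    (i : Fin 4) :
    eval p (pderiv i ((X 3 ^ m + C α * (X 0 + X 1 + X 2)) ^ 3 - C μ * (X 0 * X 1 * X 2))) =
      ![3 * α * (p 3 ^ m + α * (p 0 + p 1 + p 2)) ^ 2 - μ * (p 1 * p 2),
        3 * α * (p 3 ^ m + α * (p 0 + p 1 + p 2)) ^ 2 - μ * (p 0 * p 2),
        3 * α * (p 3 ^ m + α * (p 0 + p 1 + p 2)) ^ 2 - μ * (p 0 * p 1),
        3 * (m * p 3 ^ (m - 1)) * (p 3 ^ m + α * (p 0 + p 1 + p 2)) ^ 2] i := by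
  fin_cases i <;>
    simp [Derivation.leibniz, Derivation.leibniz_pow, pderiv_X] <;> ring

lemma ne_of_smooth_cubic {k : Type*} [Field k] {α μ : k}
    (h : ∀ p : Fin 3 → k,
      (∀ i : Fin 3, eval p (pderiv i
        ((C α * (X 0 + X 1 + X 2)) ^ 3 - C μ * (X 0 * X 1 * X 2) : MvPolynomial (Fin 3) k))
          = 0) → p = 0) : 27 * α ^ 3 ≠ μ := by
  rintro rfl
  refine one_ne_zero (congrFun (h 1 fun i ↦ ?_) 0)
  fin_cases i <;>
    simp [Derivation.leibniz, Derivation.leibniz_pow, pderiv_X] <;> ring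

/-- Singular locus of `Y = V(F) ⊂ 𝔸⁴`, case `3 ∣ n` (`n = 3m`), where
`F = g^{3m} + 3ℓg^{2m} + 3ℓ²g^{m} + Φ` with `ℓ = α(z₁+z₂+z₃)` and `Φ = ℓ³ − μz₁z₂z₃`
(having smooth associated projective cubic).  The locus where `F` and its partial
derivatives in `z₁, z₂, z₃` vanish coincides with the locus where `F` and all four partial
derivatives vanish, and both equal the union of the three dilation-invariant curves
`Cᵢ = {g^m + α·zᵢ = 0, z_j = 0 (j ≠ i)}` meeting at the origin. -/
theorem singular_locus_divisible_case
    (k : Type*) [Field k] [IsAlgClosed k] [CharZero k]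
    (m : ℕ) (hm : 1 ≤ m)
    (α μ : k) (hα : α ≠ 0) (hμ : μ ≠ 0)
    (hΦsmooth : ∀ p : Fin 3 → k,
      (∀ i : Fin 3, eval p (pderiv i
        ((C α * (X 0 + X 1 + X 2)) ^ 3 - C μ * (X 0 * X 1 * X 2) : MvPolynomial (Fin 3) k))
          = 0) → p = 0) :
    let ℓ : MvPolynomial (Fin 4) k := C α * (X 0 + X 1 + X 2)
    let Φ : MvPolynomial (Fin 4) k := ℓ ^ 3 - C μ * (X 0 * X 1 * X 2)
    let F : MvPolynomial (Fin 4) k :=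
      X 3 ^ (3 * m) + 3 * ℓ * X 3 ^ (2 * m) + 3 * ℓ ^ 2 * X 3 ^ m + Φ
    let C₁ : Set (Fin 4 → k) := {p | p 3 ^ m + α * p 0 = 0 ∧ p 1 = 0 ∧ p 2 = 0}
    let C₂ : Set (Fin 4 → k) := {p | p 3 ^ m + α * p 1 = 0 ∧ p 0 = 0 ∧ p 2 = 0}
    let C₃ : Set (Fin 4 → k) := {p | p 3 ^ m + α * p 2 = 0 ∧ p 0 = 0 ∧ p 1 = 0}
    ({p : Fin 4 → k | eval p F = 0 ∧ ∀ i : Fin 3, eval p (pderiv i.castSucc F) = 0}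
        = {p : Fin 4 → k | eval p F = 0 ∧ ∀ i : Fin 4, eval p (pderiv i F) = 0}) ∧
    ({p : Fin 4 → k | eval p F = 0 ∧ ∀ i : Fin 3, eval p (pderiv i.castSucc F) = 0}
        = C₁ ∪ C₂ ∪ C₃) := by
  intro ℓ Φ F C₁ C₂ C₃
  have hF : F = (X 3 ^ m + C α * (X 0 + X 1 + X 2)) ^ 3 - C μ * (X 0 * X 1 * X 2) := by
    simp only [F, Φ, ℓ]
    ring
  have hne := ne_of_smooth_cubic hΦsmooth
  have key : ∀ p : Fin 4 → k, eval p F = 0 → (∀ i : Fin 3, eval p (pderiv i.castSucc F) = 0) →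
      p 3 ^ m + α * (p 0 + p 1 + p 2) = 0 ∧ p 1 * p 2 = 0 ∧ p 0 * p 2 = 0 ∧ p 0 * p 1 = 0 := by
    intro p h0 h
    rw [hF, eval_cube_add_sub_prod] at h0
    have h' (i : Fin 3) := (eval_pderiv_cube_add_sub_prod m α μ p i.castSucc).symm.trans
      (hF ▸ h i)
    have hx := sub_eq_zero.1 (h' 0)
    have hy := sub_eq_zero.1 (h' 1)
    have hz := sub_eq_zero.1 (h' 2)
    have hw := eq_zero_of_cube_eq_of_sq_eq hne (sub_eq_zero.1 h0) hx hy hz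
    rw [hw] at hx hy hz
    exact ⟨hw, by simpa [hμ] using hx.symm, by simpa [hμ] using hy.symm,
      by simpa [hμ] using hz.symm⟩
  refine ⟨Set.ext fun p ↦ ⟨fun ⟨h0, h⟩ ↦ ⟨h0, ?_⟩, fun ⟨h0, h⟩ ↦ ⟨h0, fun i ↦ h _⟩⟩,
    Set.ext fun p ↦ ⟨fun ⟨h0, h⟩ ↦ ?_, fun h ↦ ?_⟩⟩
  · refine Fin.lastCases ?_ h
    rw [hF, eval_pderiv_cube_add_sub_prod, (key p h0 h).1]
    simp [Fin.last]
  · exact add_mul_sum_eq_zero_and_iff.1 (key p h0 h)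
  · obtain ⟨hw, hx, hy, hz⟩ := add_mul_sum_eq_zero_and_iff.2 h
    refine ⟨?_, fun i ↦ ?_⟩
    · rw [hF, eval_cube_add_sub_prod, hw, hz]
      simp
    · rw [hF, eval_pderiv_cube_add_sub_prod, hw, hx, hy, hz]
      fin_cases i <;> simp
end

section
/- Let n ≥ 2 be an integer, let Φ ∈ k[z₁,z₂,z₃] be homogeneous of degree 3 such that the only common zero in k³ of ∂Φ/∂z₁, ∂Φ/∂z₂, ∂Φ/∂z₃ is (0,0,0), and set F := gⁿ + Φ ∈ P := k[z₁,z₂,z₃,g]. Then: (1) the principal ideal (F) is a prime ideal of P, so A := P/(F) is an integral domain; (2) the images f₁, f₂, f₃ in A of ∂F/∂z₁, ∂F/∂z₂, ∂F/∂z₃ are nonzero; and (3) for every element x of the fraction field of A, if for each i ∈ {1,2,3} there exist a_i ∈ A and a natural number e_i with f_i^{e_i}·x = a_i (i.e., x lies in the localization A[f_i^{−1}] inside Frac(A) for each i), then x ∈ A. That is, A = ⋂_{i=1}^{3} A[f_i^{−1}] inside Frac(A). -/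
open MvPolynomial

section UniqueFactorization

variable {R : Type*} [CommRing R] [IsDomain R] [UniqueFactorizationMonoid R]

/-- Divisibility in a factorial domain can be tested locally at the primes. -/
theorem dvd_of_forall_prime_exists_dvd_mul {d : R} (hd : d ≠ 0) {c : R}
    (h : ∀ p, Prime p → p ∣ d → ∃ v, ¬ p ∣ v ∧ d ∣ v * c) : d ∣ c := by
  induction d using UniqueFactorizationMonoid.induction_on_prime generalizing c with
  | h₁ => exact absurd rfl hd
  | h₂ x hx => exact hx.dvd
  | h₃ a p ha hp ih =>
    obtain ⟨v, hv, hdv⟩ := h p hp (dvd_mul_right p a)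
    obtain ⟨c', rfl⟩ := (hp.dvd_or_dvd ((dvd_mul_right p a).trans hdv)).resolve_left hv
    refine mul_dvd_mul_left p (ih ha fun q hq hqa => ?_)
    obtain ⟨w, hw, hdw⟩ := h q hq (hqa.mul_left p)
    refine ⟨w, hw, ?_⟩
    rw [mul_left_comm] at hdw
    exact (mul_dvd_mul_iff_left hp.ne_zero).1 hdw

/-- If no prime of `R` divides all `f i`, then a compatible family of fractions
`α i / (f i) ^ (e i)` in `R[X] / (G)`, with `G` monic, comes from an element of `R[X] / (G)`. -/
theorem Polynomial.Monic.exists_dvd_sub_C_pow_mul {G : Polynomial R} (hG : G.Monic)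
    {ι : Type*} {f : ι → R} (hf0 : ∀ i, f i ≠ 0) (hf : ∀ p, Prime p → ∃ i, ¬ p ∣ f i)
    {α : ι → Polynomial R} {e : ι → ℕ}
    (h : ∀ i j, G ∣ Polynomial.C (f i ^ e i) * α j - Polynomial.C (f j ^ e j) * α i) (i : ι) :
    ∃ β, G ∣ α i - Polynomial.C (f i ^ e i) * β := by
  have hmod : ∀ j, Polynomial.C (f i ^ e i) * (α j %ₘ G) =
      Polynomial.C (f j ^ e j) * (α i %ₘ G) := fun j => by
    have := (Polynomial.modByMonic_eq_zero_iff_dvd hG).2 (h i j)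
    rwa [Polynomial.sub_modByMonic, ← Polynomial.smul_eq_C_mul, ← Polynomial.smul_eq_C_mul,
      Polynomial.smul_modByMonic, Polynomial.smul_modByMonic, Polynomial.smul_eq_C_mul,
      Polynomial.smul_eq_C_mul, sub_eq_zero] at this
  have hdvd : Polynomial.C (f i ^ e i) ∣ α i %ₘ G := by
    rw [Polynomial.C_dvd_iff_dvd_coeff]
    intro m
    refine dvd_of_forall_prime_exists_dvd_mul (pow_ne_zero _ (hf0 i)) fun p hp _ => ?_
    obtain ⟨j, hj⟩ := hf p hp
    refine ⟨f j ^ e j, fun hpj => hj (hp.dvd_of_dvd_pow hpj), (α j %ₘ G).coeff m, ?_⟩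
    simpa only [Polynomial.coeff_C_mul] using (congrArg (Polynomial.coeff · m) (hmod j)).symm
  obtain ⟨β, hβ⟩ := hdvd
  refine ⟨β, α i /ₘ G, ?_⟩
  rw [← hβ, sub_eq_iff_eq_add', Polynomial.modByMonic_add_div]

end UniqueFactorization

/-- Eisenstein's criterion for `X ^ n + c` at a prime dividing `c` exactly once. -/
theorem Polynomial.irreducible_X_pow_add_C {R : Type*} [CommRing R] [IsDomain R] {n : ℕ}
    (hn : n ≠ 0) {c p : R} (hp : Prime p) (hpc : p ∣ c) (hpc2 : ¬ p ^ 2 ∣ c) :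
    Irreducible (Polynomial.X ^ n + Polynomial.C c) := by
  have hmonic := Polynomial.monic_X_pow_add_C c hn
  have hprime : (Ideal.span {p}).IsPrime := (Ideal.span_singleton_prime hp.ne_zero).2 hp
  refine Polynomial.irreducible_of_eisenstein_criterion hprime ?_ (fun m hm => ?_) ?_ ?_
    hmonic.isPrimitive
  · rw [hmonic.leadingCoeff]
    exact hprime.one_notMem
  · rw [Polynomial.degree_X_pow_add_C (Nat.pos_of_ne_zero hn), Nat.cast_lt] at hm
    rw [Polynomial.coeff_add, Polynomial.coeff_X_pow, if_neg hm.ne, zero_add,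
      Polynomial.coeff_C, Ideal.mem_span_singleton]
    split_ifs
    exacts [hpc, dvd_zero p]
  · rw [Polynomial.degree_X_pow_add_C (Nat.pos_of_ne_zero hn)]
    exact_mod_cast Nat.pos_of_ne_zero hn
  · rw [Ideal.span_singleton_pow, Ideal.mem_span_singleton]
    simpa [Polynomial.coeff_X_pow, hn.symm] using hpc2

namespace MvPolynomial

section CommRing

variable {R σ : Type*} [CommRing R]

theorem pderiv_comm (i j : σ) (φ : MvPolynomial σ R) :
    pderiv i (pderiv j φ) = pderiv j (pderiv i φ) := by
  rcases eq_or_ne i j with rfl | hij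
  · rfl
  ext m
  simp only [coeff_pderiv, Finsupp.add_apply, Finsupp.single_eq_of_ne hij,
    Finsupp.single_eq_of_ne hij.symm, add_zero, add_right_comm m]
  ring

variable (R) in
/-- Polynomials in `n + 1` variables as polynomials in the last variable. -/
noncomputable def finSuccEquivLast (n : ℕ) :
    MvPolynomial (Fin (n + 1)) R ≃ₐ[R] Polynomial (MvPolynomial (Fin n) R) :=
  (renameEquiv R _root_.finSuccEquivLast).trans (optionEquivLeft R (Fin n))

theorem finSuccEquivLast_X_last (n : ℕ) :
    finSuccEquivLast R n (X (Fin.last n)) = Polynomial.X := by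
  simp [finSuccEquivLast]

theorem finSuccEquivLast_rename_castSucc {n : ℕ} (p : MvPolynomial (Fin n) R) :
    finSuccEquivLast R n (rename Fin.castSucc p) = Polynomial.C p := by
  have h : ((finSuccEquivLast R n).toAlgHom.comp (rename Fin.castSucc)) =
      (Algebra.ofId (MvPolynomial (Fin n) R) (Polynomial _)).restrictScalars R :=
    algHom_ext fun i => by
      simp [finSuccEquivLast, Algebra.ofId_apply, Polynomial.algebraMap_eq]
  simpa [Algebra.ofId_apply, Polynomial.algebraMap_eq] using DFunLike.congr_fun h p

end CommRing

section Field

variable {k : Type*} [Field k]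

/-- Over an algebraically closed field, a nonempty hypersurface in an affine space of dimension
at least two is not reduced to the origin. -/
theorem isUnit_of_forall_eval_eq_zero {σ : Type*} [Finite σ] [Nontrivial σ] [IsAlgClosed k]
    {q : MvPolynomial σ k} (hq : ∀ x, eval x q = 0 → x = 0) : IsUnit q := by
  have hX : ∀ i, ∃ m, q ∣ X i ^ m := fun i => by
    have : X i ∈ vanishingIdeal k (zeroLocus k (Ideal.span {q})) := by
      intro x hx
      have hx0 := hq x (by
        simpa [aeval_eq_eval] using hx q (Ideal.mem_span_singleton_self q))
      simp [hx0]
    rw [vanishingIdeal_zeroLocus_eq_radical] at this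
    obtain ⟨m, hm⟩ := this
    exact ⟨m, Ideal.mem_span_singleton.1 hm⟩
  obtain ⟨i, j, hij⟩ := exists_pair_ne σ
  obtain ⟨a, ha⟩ := hX i
  obtain ⟨b, hb⟩ := hX j
  refine IsRelPrime.pow (m := a) (n := b) ?_ ha hb
  have hirr : Irreducible (X i : MvPolynomial σ k) := X_prime.irreducible
  rw [hirr.isRelPrime_iff_not_dvd, X_dvd_X]
  exact fun h => hij h

variable {σ : Type*} {φ : MvPolynomial σ k}

theorem exists_not_dvd_pderiv_of_smooth [Finite σ] [Nontrivial σ] [IsAlgClosed k]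
    (hsmooth : ∀ x : σ → k, (∀ i, eval x (pderiv i φ) = 0) → x = 0)
    {p : MvPolynomial σ k} (hp : ¬ IsUnit p) : ∃ i, ¬ p ∣ pderiv i φ := by
  by_contra! h
  refine hp (isUnit_of_forall_eval_eq_zero fun x hx => hsmooth x fun i => ?_)
  obtain ⟨r, hr⟩ := h i
  rw [hr, eval_mul, hx, zero_mul]

theorem not_sq_dvd_of_smooth [Finite σ] [Nontrivial σ] [IsAlgClosed k]
    (hsmooth : ∀ x : σ → k, (∀ i, eval x (pderiv i φ) = 0) → x = 0)
    {p : MvPolynomial σ k} (hp : ¬ IsUnit p) : ¬ p ^ 2 ∣ φ := by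
  rintro ⟨r, rfl⟩
  obtain ⟨i, hi⟩ := exists_not_dvd_pderiv_of_smooth hsmooth hp
  refine hi ⟨2 * pderiv i p * r + p * pderiv i r, ?_⟩
  simp only [pderiv_mul, pderiv_pow]
  push_cast
  ring

/-- No partial derivative of a smooth form of degree at least three vanishes identically. -/
theorem pderiv_ne_zero_of_smooth [Fintype σ] [CharZero k] {d : ℕ} (hd : 3 ≤ d)
    (hhom : φ.IsHomogeneous d)
    (hsmooth : ∀ x : σ → k, (∀ i, eval x (pderiv i φ) = 0) → x = 0) (i : σ) :
    pderiv i φ ≠ 0 := by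
  classical
  intro h0
  have hx := hsmooth (Pi.single i 1) fun j => by
    have h := congrArg (eval (Pi.single i (1 : k))) (hhom.pderiv (i := j)).sum_X_mul_pderiv
    have hsum : ∑ x, eval (Pi.single i (1 : k)) (X x * pderiv x (pderiv j φ)) = 0 :=
      Finset.sum_eq_zero fun m _ => by
        rcases eq_or_ne m i with rfl | hm
        · rw [pderiv_comm, h0, map_zero, mul_zero, map_zero]
        · simp [hm]
    rw [map_sum, hsum, nsmul_eq_mul, map_mul, map_natCast, eq_comm, mul_eq_zero] at h
    exact h.resolve_left (Nat.cast_ne_zero.2 (by omega))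
  simpa using congrFun hx i

end Field

end MvPolynomial

open MvPolynomial

/-- For `F = gⁿ + Φ` with `Φ` a smooth homogeneous cubic in `z₁,z₂,z₃`:
(1) `(F)` is a prime ideal of `P = k[z₁,z₂,z₃,g]`, so `A = P/(F)` is a domain;
(2) the images `f₁, f₂, f₃` in `A` of `∂F/∂z₁, ∂F/∂z₂, ∂F/∂z₃` are nonzero;
(3) `A = ⋂ᵢ A[fᵢ⁻¹]` inside `Frac(A)`. -/
theorem quotient_is_intersection_of_localizations
    (k : Type*) [Field k] [IsAlgClosed k] [CharZero k]
    (n : ℕ) (hn : 2 ≤ n)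
    (Φ : MvPolynomial (Fin 3) k)
    (hΦhom : Φ.IsHomogeneous 3)
    (hΦsmooth : ∀ p : Fin 3 → k, (∀ i : Fin 3, eval p (pderiv i Φ) = 0) → p = 0) :
    let F : MvPolynomial (Fin 4) k :=
      X 3 ^ n + rename (Fin.castSucc : Fin 3 → Fin 4) Φ
    let I : Ideal (MvPolynomial (Fin 4) k) := Ideal.span {F}
    let f : Fin 3 → MvPolynomial (Fin 4) k ⧸ I :=
      fun i => Ideal.Quotient.mk I (pderiv i.castSucc F)
    I.IsPrime ∧
    (∀ i : Fin 3, f i ≠ 0) ∧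
    (∀ x : FractionRing (MvPolynomial (Fin 4) k ⧸ I),
      (∀ i : Fin 3, ∃ (a : MvPolynomial (Fin 4) k ⧸ I) (e : ℕ),
        (algebraMap _ (FractionRing (MvPolynomial (Fin 4) k ⧸ I)) (f i)) ^ e * x
          = algebraMap _ _ a) →
      ∃ a : MvPolynomial (Fin 4) k ⧸ I,
        x = algebraMap _ (FractionRing (MvPolynomial (Fin 4) k ⧸ I)) a) := by
  intro F I f
  let ε := MvPolynomial.finSuccEquivLast k 3
  have hεF : ε F = Polynomial.X ^ n + Polynomial.C Φ := by
    simp only [F, map_add, map_pow, ε, finSuccEquivLast_rename_castSucc]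
    rw [show (3 : Fin 4) = Fin.last 3 from rfl, finSuccEquivLast_X_last]
  have hmonic : (ε F).Monic := hεF ▸ Polynomial.monic_X_pow_add_C Φ (by omega)
  have hmem : ∀ q, Ideal.Quotient.mk I q = 0 ↔ ε F ∣ ε q := fun q => by
    rw [Ideal.Quotient.eq_zero_iff_mem, Ideal.mem_span_singleton, map_dvd_iff]
  have hderiv : ∀ i : Fin 3, pderiv i.castSucc F = rename Fin.castSucc (pderiv i Φ) := fun i => by
    have h3 : (3 : Fin 4) ≠ i.castSucc := (Fin.castSucc_lt_last i).ne'
    simp only [F, map_add, pderiv_pow, pderiv_X_of_ne h3, mul_zero, zero_add,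
      pderiv_rename (Fin.castSucc_injective 3)]
  have hf : ∀ i, f i = Ideal.Quotient.mk I (rename Fin.castSucc (pderiv i Φ)) := fun i =>
    congrArg _ (hderiv i)
  have hΦi := pderiv_ne_zero_of_smooth le_rfl hΦhom hΦsmooth
  have hΦ0 : Φ ≠ 0 := by
    rintro rfl
    exact hΦi 0 (map_zero _)
  have hprime : I.IsPrime := by
    have hunit : ¬ IsUnit Φ := fun h => by
      have := h.map (eval (0 : Fin 3 → k))
      rw [eval_zero, constantCoeff_eq, hΦhom.coeff_eq_zero (by simp)] at this
      exact not_isUnit_zero this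
    obtain ⟨p, hp, hpΦ⟩ := WfDvdMonoid.exists_irreducible_factor hunit hΦ0
    have hirr : Irreducible (ε F) := hεF ▸ Polynomial.irreducible_X_pow_add_C (by omega)
      hp.prime hpΦ (not_sq_dvd_of_smooth hΦsmooth hp.not_isUnit)
    have hF : Prime F := (MulEquiv.prime_iff ε.toMulEquiv).1 hirr.prime
    exact (Ideal.span_singleton_prime hF.ne_zero).2 hF
  have hf0 : ∀ i, f i ≠ 0 := fun i hi => by
    rw [hf, hmem, finSuccEquivLast_rename_castSucc] at hi
    refine hmonic.not_dvd_of_natDegree_lt (Polynomial.C_ne_zero.2 (hΦi i)) ?_ hi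
    rw [Polynomial.natDegree_C, hεF, Polynomial.natDegree_X_pow_add_C]
    omega
  refine ⟨hprime, hf0, fun x hx => ?_⟩
  have : IsDomain (MvPolynomial (Fin 4) k ⧸ I) := Ideal.Quotient.isDomain I
  choose a e hae using hx
  choose α hα using fun i => Ideal.Quotient.mk_surjective (a i)
  have hinj := IsFractionRing.injective (MvPolynomial (Fin 4) k ⧸ I)
    (FractionRing (MvPolynomial (Fin 4) k ⧸ I))
  have hcompat : ∀ i j, ε F ∣ Polynomial.C (pderiv i Φ ^ e i) * ε (α j) -
      Polynomial.C (pderiv j Φ ^ e j) * ε (α i) := fun i j => by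
    have h : f i ^ e i * a j = f j ^ e j * a i := hinj (by
      simp only [map_mul, map_pow, ← hae]
      ring)
    rw [← sub_eq_zero, ← hα, ← hα, hf, hf, ← map_pow (Ideal.Quotient.mk I),
      ← map_pow (Ideal.Quotient.mk I), ← map_mul, ← map_mul, ← map_sub,
      hmem] at h
    simpa only [map_sub, map_mul, map_pow, ε, finSuccEquivLast_rename_castSucc] using h
  obtain ⟨β, hβ⟩ := hmonic.exists_dvd_sub_C_pow_mul hΦi
    (fun p hp => exists_not_dvd_pderiv_of_smooth hΦsmooth hp.not_isUnit) hcompat 0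
  refine ⟨Ideal.Quotient.mk I (ε.symm β), ?_⟩
  have ha : a 0 = f 0 ^ e 0 * Ideal.Quotient.mk I (ε.symm β) := by
    rw [← sub_eq_zero, ← hα, hf, ← map_pow (Ideal.Quotient.mk I), ← map_mul, ← map_sub, hmem]
    simpa only [map_sub, map_mul, map_pow, ε, finSuccEquivLast_rename_castSucc,
      AlgEquiv.apply_symm_apply] using hβ
  have h := hae 0
  rw [ha, map_mul, map_pow] at h
  exact mul_left_cancel₀ (pow_ne_zero _ ((map_ne_zero_iff _ hinj).2 (hf0 0))) h
end

section
/- Let n ≥ 2 be an integer and grade P := k[z₁,z₂,z₃,g] by deg z₁ = deg z₂ = deg z₃ = n and deg g = 3. Let F ∈ P be homogeneous of degree 3n such that: (F) is a prime ideal; the images f₁, f₂, f₃ in A := P/(F) of ∂F/∂z₁, ∂F/∂z₂, ∂F/∂z₃ are nonzero; and every element of Frac(A) lying in each localization A[f_i^{−1}] (i = 1,2,3) lies in A. Let {·,·} : A × A → A be a Poisson bracket (k-bilinear, antisymmetric, a derivation in each argument, satisfying the Jacobi identity) which is homogeneous of degree 0 for the induced grading on A (i.e., {A_p, A_q} ⊆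 A_{p+q}) and such that the image ḡ of g is Poisson central ({ḡ, a} = 0 for all a ∈ A). Then there exists a scalar η ∈ k such that, in A, {z̄₁, z̄₂} = η·f₃, {z̄₂, z̄₃} = η·f₁, and {z̄₃, z̄₁} = η·f₂, where z̄_i denotes the image of z_i. -/
open MvPolynomial

/-- The chain rule: a derivation of a polynomial ring is determined by its values on the
variables through the partial derivatives. -/
theorem MvPolynomial.derivation_apply_eq_sum_pderiv {R σ M : Type*} [CommRing R] [Fintype σ]
    [AddCommGroup M] [Module R M] [Module (MvPolynomial σ R) M]
    [IsScalarTower R (MvPolynomial σ R) M]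
    (D : Derivation R (MvPolynomial σ R) M) (p : MvPolynomial σ R) :
    D p = ∑ i, pderiv i p • D (X i) := by
  classical
  induction p using MvPolynomial.induction_on with
  | C a => simp
  | add p q hp hq => simp only [map_add, hp, hq, add_smul, Finset.sum_add_distrib]
  | mul_X p j hp =>
    simp only [Derivation.leibniz, hp, pderiv_X, add_smul, Finset.sum_add_distrib, smul_eq_mul,
      mul_smul, Finset.smul_sum]
    congr 1
    rw [Finset.sum_eq_single j (by intro i _ hij; simp [hij.symm]) (by simp)]
    simp

section

attribute [local instance] MvPolynomial.weightedGradedAlgebra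

/-- The component of degree `d` of a product `p * h` with `h` homogeneous of degree `d`, for
nowhere vanishing weights. -/
theorem MvPolynomial.IsWeightedHomogeneous.weightedHomogeneousComponent_mul_self
    {R σ : Type*} [CommRing R] {w : σ → ℕ} (hw : ∀ i, w i ≠ 0) {h : MvPolynomial σ R} {d : ℕ}
    (hh : h.IsWeightedHomogeneous w d) (p : MvPolynomial σ R) :
    weightedHomogeneousComponent w d (p * h) = C (coeff 0 p) * h := by
  have key := DirectSum.coe_decompose_mul_of_right_mem_of_le
    (weightedHomogeneousSubmodule R w) (a := p) hh le_rfl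
  rw [Nat.sub_self] at key
  rw [← weightedHomogeneousComponent_zero p hw, ← decompose'_apply, ← decompose'_apply]
  exact key

theorem MvPolynomial.IsWeightedHomogeneous.weightedHomogeneousComponent_mul_of_lt
    {R σ : Type*} [CommRing R] {w : σ → ℕ} {h : MvPolynomial σ R} {d e : ℕ}
    (hh : h.IsWeightedHomogeneous w d) (hed : e < d) (p : MvPolynomial σ R) :
    weightedHomogeneousComponent w e (h * p) = 0 := by
  have key := DirectSum.coe_decompose_mul_of_left_mem_of_not_le
    (weightedHomogeneousSubmodule R w) (b := p) hh (not_le.mpr hed)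
  rw [← decompose'_apply]
  exact key

end

/-- If `h` and `q` are homogeneous of degree `d` and `q ≡ p * h` modulo a form of degree larger
than `d`, then `p` may be replaced by its constant coefficient. -/
theorem MvPolynomial.IsWeightedHomogeneous.eq_C_mul_of_mul_sub_mem_span
    {R σ : Type*} [CommRing R] {w : σ → ℕ} (hw : ∀ i, w i ≠ 0) {h q F : MvPolynomial σ R}
    {d e : ℕ} (hh : h.IsWeightedHomogeneous w d) (hq : q.IsWeightedHomogeneous w d)
    (hF : F.IsWeightedHomogeneous w e) (hde : d < e) {p : MvPolynomial σ R}
    (hmem : p * h - q ∈ Ideal.span {F}) : q = C (coeff 0 p) * h := by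
  obtain ⟨r, hr⟩ := Ideal.mem_span_singleton'.mp hmem
  have key := congrArg (weightedHomogeneousComponent w d) hr
  rw [mul_comm r, hF.weightedHomogeneousComponent_mul_of_lt hde, map_sub,
    hh.weightedHomogeneousComponent_mul_self hw, hq.weightedHomogeneousComponent_same] at key
  exact (sub_eq_zero.mp key.symm).symm

/-- A derivation of a quotient of a polynomial ring, evaluated on the class of a polynomial. -/
theorem MvPolynomial.quotient_apply_mk_eq_sum_pderiv {R σ : Type*} [CommRing R] [Fintype σ]
    {I : Ideal (MvPolynomial σ R)}
    (δ : (MvPolynomial σ R ⧸ I) → (MvPolynomial σ R ⧸ I))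
    (δ_add : ∀ x y, δ (x + y) = δ x + δ y) (δ_smul : ∀ (a : R) x, δ (a • x) = a • δ x)
    (δ_mul : ∀ x y, δ (x * y) = δ x * y + x * δ y) (p : MvPolynomial σ R) :
    δ (Ideal.Quotient.mk I p) =
      ∑ i, Ideal.Quotient.mk I (pderiv i p) * δ (Ideal.Quotient.mk I (X i)) := by
  let L : MvPolynomial σ R →ₗ[R] (MvPolynomial σ R ⧸ I) :=
    { toFun := fun p => δ (Ideal.Quotient.mk I p)
      map_add' := fun p q => by rw [map_add, δ_add]
      map_smul' := fun a p => δ_smul a (Ideal.Quotient.mk I p) }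
  let D : Derivation R (MvPolynomial σ R) (MvPolynomial σ R ⧸ I) :=
    Derivation.mk' L fun p q => by
      change δ (Ideal.Quotient.mk I (p * q)) = Ideal.Quotient.mk I p * δ (Ideal.Quotient.mk I q) +
        Ideal.Quotient.mk I q * δ (Ideal.Quotient.mk I p)
      rw [map_mul, δ_mul]
      ring
  exact derivation_apply_eq_sum_pderiv D p

/-- Classification of homogeneous Poisson brackets with `ḡ` Poisson central on
`A = k[z₁,z₂,z₃,g]/(F)`, where `deg zᵢ = n`, `deg g = 3` and `F` is homogeneous of degree
`3n`, `(F)` is prime, the images `fᵢ` of `∂F/∂zᵢ` are nonzero, and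
`A = ⋂ᵢ A[fᵢ⁻¹]` in `Frac(A)`.  Every such bracket satisfies
`{z̄₁,z̄₂} = η·f₃`, `{z̄₂,z̄₃} = η·f₁`, `{z̄₃,z̄₁} = η·f₂` for some scalar `η ∈ k`. -/
theorem homogeneous_poisson_bracket_form
    (k : Type*) [Field k] [IsAlgClosed k] [CharZero k]
    (n : ℕ) (hn : 2 ≤ n)
    (w : Fin 4 → ℕ) (hw0 : w 0 = n) (hw1 : w 1 = n) (hw2 : w 2 = n) (hw3 : w 3 = 3)
    (F : MvPolynomial (Fin 4) k)
    (hFhom : F.IsWeightedHomogeneous w (3 * n))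
    (I : Ideal (MvPolynomial (Fin 4) k)) (hI : I = Ideal.span {F})
    (hIprime : I.IsPrime)
    (f : Fin 3 → MvPolynomial (Fin 4) k ⧸ I)
    (hf : ∀ i : Fin 3, f i = Ideal.Quotient.mk I (pderiv i.castSucc F))
    (hfne : ∀ i : Fin 3, f i ≠ 0)
    (hintersect : ∀ x : FractionRing (MvPolynomial (Fin 4) k ⧸ I),
      (∀ i : Fin 3, ∃ (a : MvPolynomial (Fin 4) k ⧸ I) (e : ℕ),
        (algebraMap _ (FractionRing (MvPolynomial (Fin 4) k ⧸ I)) (f i)) ^ e * x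
          = algebraMap _ _ a) →
      ∃ a : MvPolynomial (Fin 4) k ⧸ I,
        x = algebraMap _ (FractionRing (MvPolynomial (Fin 4) k ⧸ I)) a)
    -- the Poisson bracket on A = P/(F)
    (br : (MvPolynomial (Fin 4) k ⧸ I) → (MvPolynomial (Fin 4) k ⧸ I) →
      (MvPolynomial (Fin 4) k ⧸ I))
    (br_add_left : ∀ x y z, br (x + y) z = br x z + br y z)
    (br_add_right : ∀ x y z, br x (y + z) = br x y + br x z)
    (br_smul_left : ∀ (α : k) x y, br (α • x) y = α • br x y)
    (br_smul_right : ∀ (α : k) x y, br x (α • y) = α • br x y)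
    (br_antisymm : ∀ x y, br x y = - br y x)
    (br_leibniz_left : ∀ x y z, br (x * y) z = x * br y z + br x z * y)
    (br_leibniz_right : ∀ x y z, br x (y * z) = br x y * z + y * br x z)
    (br_jacobi : ∀ x y z, br x (br y z) + br y (br z x) + br z (br x y) = 0)
    -- the bracket is homogeneous of degree 0 for the induced grading on A
    (br_graded : ∀ (p q : ℕ) (x y : MvPolynomial (Fin 4) k ⧸ I),
      x ∈ Submodule.map (Ideal.Quotient.mkₐ k I).toLinearMap
            (weightedHomogeneousSubmodule k w p) →
      y ∈ Submodule.map (Ideal.Quotient.mkₐ k I).toLinearMap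
            (weightedHomogeneousSubmodule k w q) →
      br x y ∈ Submodule.map (Ideal.Quotient.mkₐ k I).toLinearMap
            (weightedHomogeneousSubmodule k w (p + q)))
    -- ḡ is Poisson central
    (br_g_central : ∀ x, br (Ideal.Quotient.mk I (X 3)) x = 0) :
    ∃ η : k,
      br (Ideal.Quotient.mk I (X 0)) (Ideal.Quotient.mk I (X 1)) = η • f 2 ∧
      br (Ideal.Quotient.mk I (X 1)) (Ideal.Quotient.mk I (X 2)) = η • f 0 ∧
      br (Ideal.Quotient.mk I (X 2)) (Ideal.Quotient.mk I (X 0)) = η • f 1 := by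
  have hdom : IsDomain (MvPolynomial (Fin 4) k ⧸ I) := Ideal.Quotient.isDomain I
  have hw : ∀ i, w i ≠ 0 := by
    intro i
    fin_cases i <;> simp <;> omega
  have hchar : CharZero (MvPolynomial (Fin 4) k ⧸ I) :=
    charZero_of_injective_algebraMap (algebraMap k _).injective
  have br_self (x) : br x x = 0 := CharZero.eq_neg_self_iff.mp (br_antisymm x x)
  have br_zero (x) : br x 0 = 0 := by simpa using br_smul_right 0 x 0
  have hF0 : Ideal.Quotient.mk I F = 0 :=
    Ideal.Quotient.eq_zero_iff_mem.mpr (hI ▸ Ideal.mem_span_singleton_self F)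
  have chain (x) : f 0 * br x (Ideal.Quotient.mk I (X 0)) +
      f 1 * br x (Ideal.Quotient.mk I (X 1)) + f 2 * br x (Ideal.Quotient.mk I (X 2)) = 0 := by
    have h := quotient_apply_mk_eq_sum_pderiv (br x) (br_add_right x)
      (fun a => br_smul_right a x) (br_leibniz_right x) F
    rw [hF0, br_zero, Fin.sum_univ_castSucc, Fin.sum_univ_three] at h
    have h3 : br x (Ideal.Quotient.mk I (X (Fin.last 3))) = 0 := by
      rw [br_antisymm]
      exact neg_eq_zero.mpr (br_g_central x)
    rw [h3, mul_zero, add_zero] at h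
    rw [hf, hf, hf]
    exact h.symm
  set z₀ := Ideal.Quotient.mk I (X 0)
  set z₁ := Ideal.Quotient.mk I (X 1)
  set z₂ := Ideal.Quotient.mk I (X 2)
  have h01 : f 1 * br z₁ z₂ = f 0 * br z₂ z₀ := by
    have h := chain z₂
    rw [br_self, br_antisymm z₂ z₁] at h
    linear_combination -h
  have h02 : f 2 * br z₁ z₂ = f 0 * br z₀ z₁ := by
    have h := chain z₁
    rw [br_self, br_antisymm z₁ z₀] at h
    linear_combination h
  set φ := algebraMap (MvPolynomial (Fin 4) k ⧸ I) (FractionRing (MvPolynomial (Fin 4) k ⧸ I))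
    with hφ
  have hφ0 : φ (f 0) ≠ 0 := fun h =>
    hfne 0 (IsFractionRing.injective _ (FractionRing (MvPolynomial (Fin 4) k ⧸ I))
      (h.trans (map_zero φ).symm))
  have quot {i : Fin 3} {b} (hb : f i * br z₁ z₂ = f 0 * b) :
      φ (f i) ^ 1 * (φ (br z₁ z₂) / φ (f 0)) = φ b := by
    rw [pow_one, ← mul_div_assoc, ← map_mul, hb, map_mul, mul_div_cancel_left₀ _ hφ0]
  obtain ⟨a, ha⟩ := hintersect (φ (br z₁ z₂) / φ (f 0)) fun i => by
    fin_cases i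
    · exact ⟨_, 1, quot rfl⟩
    · exact ⟨_, 1, quot h01⟩
    · exact ⟨_, 1, quot h02⟩
  have ha0 : br z₁ z₂ = a * f 0 := by
    apply IsFractionRing.injective _ (FractionRing (MvPolynomial (Fin 4) k ⧸ I))
    rw [map_mul, ← hφ, ← ha, div_mul_cancel₀ _ hφ0]
  obtain ⟨p, rfl⟩ := Ideal.Quotient.mk_surjective a
  obtain ⟨q, hq, hqb⟩ := br_graded n n z₁ z₂
    ⟨X 1, hw1 ▸ isWeightedHomogeneous_X k w 1, rfl⟩ ⟨X 2, hw2 ▸ isWeightedHomogeneous_X k w 2, rfl⟩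
  replace hqb : Ideal.Quotient.mk I q = br z₁ z₂ := hqb
  have hpd : (pderiv (Fin.castSucc (0 : Fin 3)) F).IsWeightedHomogeneous w (n + n) :=
    hFhom.pderiv (by change n + n + w 0 = 3 * n; omega)
  have hmem : p * pderiv (Fin.castSucc (0 : Fin 3)) F - q ∈ Ideal.span {F} := by
    rw [← hI, ← Ideal.Quotient.eq_zero_iff_mem, map_sub, map_mul, ← hf, hqb, ha0, sub_self]
  have hqC := hpd.eq_C_mul_of_mul_sub_mem_span hw hq hFhom (by omega) hmem
  have hη : br z₁ z₂ = coeff 0 p • f 0 := by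
    rw [← hqb, hqC, hf, ← smul_eq_C_mul]
    rfl
  have cancel {i : Fin 3} {b} (hb : f i * br z₁ z₂ = f 0 * b) : b = coeff 0 p • f i := by
    apply mul_left_cancel₀ (hfne 0)
    rw [← hb, hη, mul_smul_comm, mul_smul_comm, mul_comm]
  exact ⟨coeff 0 p, cancel h02, hη, cancel h01⟩
end
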